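/- arXiv:2303.05507 — 2 statements merged into one kernel-verified Lean document; each statement's English description precedes it below -/
import Mathlib

section
/- Let T be a tree with maximum degree Δ(T). If φ is a partial proper edge coloring of at most Δ(T) edges of T □ K_2 using colors {1,...,Δ(T)}, then φ can be extended to a proper (Δ(T)+1)-edge coloring of T □ K_2. -/
open SimpleGraph

variable {V : Type*}

/-- Two edges of `G` are adjacent if both are edges, they are distinct,
and they share a vertex. -/
def EdgeAdj (G : SimpleGraph V) (e f : Sym2 V) : Prop :=
  e ∈ G.edgeSet ∧ f ∈ G.edgeSet ∧ e ≠ f ∧ ∃ v, v ∈ e ∧ v ∈ f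

/-- A proper edge coloring (with natural-number colors). -/
def IsProperEdgeColoring (G : SimpleGraph V) (C : Sym2 V → ℕ) : Prop :=
  ∀ ⦃e f⦄, EdgeAdj G e f → C e ≠ C f

/-- A partial proper edge coloring: colored edges are edges of `G`, and
adjacent colored edges receive distinct colors. -/
def IsPartialProperEdgeColoring (G : SimpleGraph V) (φ : Sym2 V → Option ℕ) : Prop :=
  (∀ e, φ e ≠ none → e ∈ G.edgeSet) ∧
  ∀ ⦃e f⦄, EdgeAdj G e f → φ e ≠ none → φ e ≠ φ f

/-- The partial coloring uses colors from `{0, ..., t-1}`. -/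
def UsesColors (φ : Sym2 V → Option ℕ) (t : ℕ) : Prop :=
  ∀ e a, φ e = some a → a < t

/-- The (total) coloring uses colors from `{0, ..., t-1}` on all edges of `G`. -/
def ColorsBelow (G : SimpleGraph V) (C : Sym2 V → ℕ) (t : ℕ) : Prop :=
  ∀ e ∈ G.edgeSet, C e < t

/-- `C` agrees with the partial coloring `φ` on all precolored edges. -/
def ExtendsColoring (C : Sym2 V → ℕ) (φ : Sym2 V → Option ℕ) : Prop :=
  ∀ e a, φ e = some a → C e = a

/-- `φ` extends to a proper edge coloring of `G` with `t` colors. -/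
def Extendable (G : SimpleGraph V) (φ : Sym2 V → Option ℕ) (t : ℕ) : Prop :=
  ∃ C, IsProperEdgeColoring G C ∧ ColorsBelow G C t ∧ ExtendsColoring C φ

/-- The set of precolored edges of `φ`. -/
def Precolored (φ : Sym2 V → Option ℕ) : Set (Sym2 V) := {e | φ e ≠ none}

/-- The chromatic index: least `t` admitting a proper edge coloring with `t` colors. -/
noncomputable def chromaticIndex (G : SimpleGraph V) : ℕ :=
  sInf {t | ∃ C, IsProperEdgeColoring G C ∧ ColorsBelow G C t}

/-- A set of edges is independent (a matching) if no two distinct members share a vertex. -/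
def IndependentEdges (S : Set (Sym2 V)) : Prop :=
  ∀ e ∈ S, ∀ f ∈ S, e ≠ f → ∀ v, v ∈ e → v ∉ f

section TreeDistance

variable {T : SimpleGraph V}

/-- The vertices closer to `x` than to `v`; for an edge `vx` of a tree, this is the component
of `x` after deleting that edge. -/
def branch (T : SimpleGraph V) (v x : V) : Set V := {z | T.dist z x < T.dist z v}

lemma mem_branch {v x z : V} : z ∈ branch T v x ↔ T.dist z x < T.dist z v := Iff.rfl

lemma SimpleGraph.IsTree.exists_adj_dist_succ (hT : T.IsTree) {z x : V} (h : x ≠ z) :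
    ∃ y, T.Adj x y ∧ T.dist z y + 1 = T.dist z x := by
  obtain ⟨p, hp⟩ := hT.connected.exists_walk_length_eq_dist x z
  cases p with
  | nil => exact absurd rfl h
  | @cons _ y _ hxy q =>
    refine ⟨y, hxy, ?_⟩
    have h1 := dist_le q
    have h2 := hT.dist_eq_dist_add_one_of_adj z hxy
    rw [Walk.length_cons] at hp
    rw [T.dist_comm (u := z), T.dist_comm (u := z)] at *
    omega

lemma SimpleGraph.IsTree.eq_of_dist_lt (hT : T.IsTree) {z x y y' : V} (h : T.Adj x y) (h' : T.Adj x y')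
    (hd : T.dist z y < T.dist z x) (hd' : T.dist z y' < T.dist z x) : y = y' := by
  have key : ∀ w, T.Adj x w → T.dist z w < T.dist z x →
      ∃ p : T.Walk x z, p.IsPath ∧ p.snd = w := by
    intro w hw hlt
    obtain ⟨q, hq⟩ := hT.connected.exists_walk_length_eq_dist w z
    refine ⟨Walk.cons hw q, Walk.isPath_of_length_eq_dist _ ?_, by simp⟩
    have := hT.dist_eq_dist_add_one_of_adj z hw
    rw [Walk.length_cons, hq, T.dist_comm (v := z), T.dist_comm (v := z)]
    omega
  obtain ⟨p, hp, rfl⟩ := key y h hd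
  obtain ⟨q, hq, rfl⟩ := key y' h' hd'
  rw [(hT.existsUnique_path x z).unique hp hq]

lemma SimpleGraph.IsTree.mem_branch_or (hT : T.IsTree) {v x : V} (h : T.Adj v x) (z : V) :
    z ∈ branch T v x ∨ z ∈ branch T x v := by
  have := hT.dist_ne_of_adj z h
  simp only [mem_branch]
  omega

lemma notMem_branch_symm {v x z : V} (h : z ∈ branch T v x) : z ∉ branch T x v := by
  simp only [mem_branch] at *
  omega

lemma SimpleGraph.IsTree.mem_branch_right (hT : T.IsTree) {v x : V} (h : T.Adj v x) : x ∈ branch T v x := by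
  rw [mem_branch, T.dist_self]
  exact hT.connected.pos_dist_of_ne h.ne'

/-- The only edge joining the two sides of a tree edge is that edge itself. -/
lemma SimpleGraph.IsTree.eq_of_adj_branch (hT : T.IsTree) {v x a b : V} (h : T.Adj v x) (hab : T.Adj a b)
    (ha : a ∈ branch T v x) (hb : b ∈ branch T x v) : a = x ∧ b = v := by
  rw [mem_branch] at ha hb
  have hav := hT.dist_eq_dist_add_one_of_adj a h
  have hbv := hT.dist_eq_dist_add_one_of_adj b h
  have h1 := hT.dist_eq_dist_add_one_of_adj v hab
  have h2 := hT.dist_eq_dist_add_one_of_adj x hab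
  have c1 := T.dist_comm (u := a) (v := x)
  have c2 := T.dist_comm (u := a) (v := v)
  have c3 := T.dist_comm (u := b) (v := x)
  have c4 := T.dist_comm (u := b) (v := v)
  have hax : a = x := by
    by_contra hne
    obtain ⟨y, hy, hyd⟩ := hT.exists_adj_dist_succ hne
    have h3 := hT.dist_eq_dist_add_one_of_adj y h
    have h4 := hT.dist_eq_dist_add_one_of_adj v hy
    have c5 := T.dist_comm (u := y) (v := x)
    have c6 := T.dist_comm (u := y) (v := v)
    have : b = y := hT.eq_of_dist_lt (z := v) hab hy (by omega) (by omega)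
    subst this
    omega
  refine ⟨hax, ?_⟩
  subst hax
  rw [T.dist_self] at *
  have : T.dist b v = 0 := by omega
  exact (hT.connected.dist_eq_zero_iff).1 this

lemma SimpleGraph.IsTree.branch_ssubset (hT : T.IsTree) {v x y : V} (hvx : T.Adj v x) (hxy : T.Adj x y)
    (hne : y ≠ v) : branch T x y ⊂ branch T v x := by
  refine ⟨fun z hz => ?_, fun hsub => ?_⟩
  · rcases hT.mem_branch_or hvx z with h | h
    · exact h
    · exact absurd (hT.eq_of_dist_lt hxy hvx.symm hz h) hne
  · have := hsub (hT.mem_branch_right hvx)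
    simp [mem_branch] at this

/-- If the edge `vx` lies on the `b`-side of `ab` and `a` lies on the `v`-side of `vx`,
then the whole `x`-side of `vx` lies on the `b`-side of `ab`. -/
lemma SimpleGraph.IsTree.branch_subset_branch (hT : T.IsTree) {v x a b : V} (hvx : T.Adj v x)
    (hab : T.Adj a b) (hv : v ∈ branch T a b) (hx : x ∈ branch T a b) (ha : a ∈ branch T x v) :
    branch T v x ⊆ branch T a b := by
  have key : ∀ n z, T.dist a z = n → z ∈ branch T b a → z ∈ branch T x v := by
    intro n
    induction n with
    | zero =>
      intro z hz _
      rwa [← (hT.connected.dist_eq_zero_iff).1 hz]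
    | succ n ih =>
      intro z hz hzb
      have hza : z ≠ a := by
        rintro rfl
        simp at hz
      obtain ⟨y, hy, hyd⟩ := hT.exists_adj_dist_succ hza
      have hyb : y ∈ branch T b a := by
        rw [mem_branch] at hzb ⊢
        have h1 := hT.dist_eq_dist_add_one_of_adj b hy
        have c1 := T.dist_comm (u := y) (v := a)
        have c2 := T.dist_comm (u := y) (v := b)
        have c3 := T.dist_comm (u := z) (v := a)
        have c4 := T.dist_comm (u := z) (v := b)
        omega
      have hyv := ih y (by omega) hyb
      rcases hT.mem_branch_or hvx z with h | h
      · obtain ⟨rfl, rfl⟩ := hT.eq_of_adj_branch hvx hy h hyv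
        exact absurd hyb (notMem_branch_symm hv)
      · exact h
  intro z hz
  rcases hT.mem_branch_or hab z with h | h
  · exact h
  · exact absurd (key _ z rfl h) (notMem_branch_symm hz)

end TreeDistance

section TreeColoring

/-- A partial injection on a finset extends to an injection into any large enough palette. -/
lemma exists_injOn_extend {N : Finset V} {S : Finset ℕ} (hcard : N.card ≤ S.card)
    (ψ : V → Option ℕ) (hinj : ∀ a ∈ N, ∀ b ∈ N, ∀ c, ψ a = some c → ψ b = some c → a = b)
    (hS : ∀ a ∈ N, ∀ c, ψ a = some c → c ∈ S) :
    ∃ g : V → ℕ, Set.InjOn g N ∧ (∀ a ∈ N, g a ∈ S) ∧ ∀ a ∈ N, ∀ c, ψ a = some c → g a = c := by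
  classical
  set M : Finset N := Finset.univ.filter fun a => (ψ a).isSome with hM
  set f : N → ℕ := fun a => (ψ a).getD 0 with hf
  have hMf : ∀ a ∈ M, ψ a = some (f a) := by
    intro a ha
    obtain ⟨c, hc⟩ := Option.isSome_iff_exists.1 (Finset.mem_filter.1 ha).2
    simp [hf, hc]
  have hfinj : Set.InjOn f M := by
    intro a ha b hb hab
    have hb' := hMf b hb
    rw [← hab] at hb'
    exact Subtype.ext (hinj a a.2 b b.2 _ (hMf a ha) hb')
  have himg : M.image f ⊆ S := by
    intro c hc
    obtain ⟨a, ha, rfl⟩ := Finset.mem_image.1 hc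
    exact hS a a.2 _ (hMf a ha)
  obtain ⟨t, h1, h2, h3⟩ := Finset.exists_subsuperset_card_eq (n := N.card) himg
    (Finset.card_image_le.trans ((Finset.card_le_univ M).trans (by simp))) hcard
  obtain ⟨g, hg⟩ := Finset.exists_equiv_extend_of_card_eq (α := N) (t := t) (by simp [h3]) h1 hfinj
  refine ⟨fun a => if h : a ∈ N then (g ⟨a, h⟩ : ℕ) else 0, ?_, ?_, ?_⟩
  · intro a ha b hb hab
    have ha' : a ∈ N := ha
    have hb' : b ∈ N := hb
    simp only [ha', hb', dif_pos] at hab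
    simpa using g.injective (Subtype.ext hab)
  · intro a ha
    simp only [ha, dif_pos]
    exact h2 (g ⟨a, ha⟩).2
  · intro a ha c hc
    have hmem : (⟨a, ha⟩ : N) ∈ M := by simp [hM, hc]
    simp only [ha, dif_pos]
    rw [hg _ hmem]
    simp [hf, hc]

/-- A partial coloring of the edges at one vertex `u` of a tree extends to a proper edge coloring
with any palette whose size bounds all degrees. Here `L a b` is the color of the edge `ab`. -/
lemma SimpleGraph.IsTree.exists_edge_coloring_extending_star [Fintype V] {T : SimpleGraph V}
    [DecidableRel T.Adj] (hT : T.IsTree) {S : Finset ℕ} (hdeg : ∀ v, T.degree v ≤ S.card) (u : V)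
    (ψ : V → Option ℕ)
    (hinj : ∀ a b, T.Adj u a → T.Adj u b → ∀ c, ψ a = some c → ψ b = some c → a = b)
    (hS : ∀ a, T.Adj u a → ∀ c, ψ a = some c → c ∈ S) :
    ∃ L : V → V → ℕ, (∀ a b, T.Adj a b → L a b = L b a) ∧ (∀ a b, T.Adj a b → L a b ∈ S) ∧
      (∀ a, Set.InjOn (L a) (T.neighborSet a)) ∧
      ∀ a, T.Adj u a → ∀ c, ψ a = some c → L u a = c := by
  classical
  have hstar : ∀ v (χ : V → Option ℕ),
      (∀ a b, T.Adj v a → T.Adj v b → ∀ c, χ a = some c → χ b = some c → a = b) →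
      (∀ a, T.Adj v a → ∀ c, χ a = some c → c ∈ S) →
      ∃ g : V → ℕ, Set.InjOn g (T.neighborSet v) ∧ (∀ a, T.Adj v a → g a ∈ S) ∧
        ∀ a, T.Adj v a → ∀ c, χ a = some c → g a = c := by
    intro v χ h1 h2
    obtain ⟨g, hg1, hg2, hg3⟩ := exists_injOn_extend (N := T.neighborFinset v) (S := S)
      (by simpa using hdeg v) χ (by simpa using fun a ha b hb => h1 a b ha hb) (by simpa using h2)
    exact ⟨g, by simpa using hg1, by simpa using hg2, by simpa using hg3⟩
  obtain ⟨f, hf1, hf2, hf3⟩ := hstar u ψ hinj hS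
  have hpar : ∀ v, ∃ w, v ≠ u → T.Adj v w ∧ T.dist u w + 1 = T.dist u v := by
    intro v
    by_cases h : v = u
    · exact ⟨v, fun h' => absurd h h'⟩
    · obtain ⟨w, hw⟩ := hT.exists_adj_dist_succ h
      exact ⟨w, fun _ => hw⟩
  choose par hpar using hpar
  have hext : ∀ v w α, ∃ g : V → ℕ, T.Adj v w → α ∈ S →
      Set.InjOn g (T.neighborSet v) ∧ (∀ a, T.Adj v a → g a ∈ S) ∧ g w = α := by
    intro v w α
    by_cases h : T.Adj v w ∧ α ∈ S
    · obtain ⟨g, hg1, hg2, hg3⟩ := hstar v (fun a => if a = w then some α else none)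
        (by intro a b _ _ c; grind) (by intro a _ c; grind)
      exact ⟨g, fun _ _ => ⟨hg1, hg2, hg3 w h.1 α (by simp)⟩⟩
    · exact ⟨fun _ => 0, fun h1 h2 => absurd ⟨h1, h2⟩ h⟩
  choose ext hext using hext
  let K : ℕ → V → V → ℕ := fun n =>
    Nat.rec (fun _ => f) (fun _ L v => ext v (par v) (L (par v) v)) n
  have hK : ∀ n v, T.dist u v = n → Set.InjOn (K n v) (T.neighborSet v) ∧
      (∀ a, T.Adj v a → K n v a ∈ S) ∧
      ∀ m, n = m + 1 → K n v (par v) = K m (par v) v := by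
    intro n
    induction n with
    | zero =>
      intro v hv
      obtain rfl := (hT.connected.dist_eq_zero_iff).1 hv
      exact ⟨hf1, hf2, by simp⟩
    | succ n ih =>
      intro v hv
      have hvu : v ≠ u := by
        rintro rfl
        simp at hv
      obtain ⟨hadj, hd⟩ := hpar v hvu
      obtain ⟨h1, h2, h3⟩ := hext v (par v) (K n (par v) v) hadj
        ((ih (par v) (by omega)).2.1 v hadj.symm)
      refine ⟨h1, h2, fun m hm => ?_⟩
      obtain rfl : n = m := by omega
      exact h3
  have hsymm : ∀ a b, T.Adj a b → T.dist u a = T.dist u b + 1 →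
      K (T.dist u a) a b = K (T.dist u b) b a := by
    intro a b hab hd
    have hau : a ≠ u := by
      rintro rfl
      simp at hd
    obtain ⟨h1, h2⟩ := hpar a hau
    have : b = par a := hT.eq_of_dist_lt (z := u) hab h1 (by omega) (by omega)
    have h3 := (hK _ a rfl).2.2 _ hd
    rwa [← this] at h3
  refine ⟨fun v => K (T.dist u v) v, fun a b hab => ?_, fun a b hab => (hK _ a rfl).2.1 b hab,
    fun a => (hK _ a rfl).1, fun a ha c hc => ?_⟩
  · rcases hT.dist_eq_dist_add_one_of_adj u hab with h | h
    · exact hsymm a b hab h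
    · exact (hsymm b a hab.symm h).symm
  · simp only [T.dist_self]
    exact hf3 a ha c hc

end TreeColoring

section Prism

/-- The prism `T □ K₂`. -/
abbrev prism (T : SimpleGraph V) : SimpleGraph (V × Fin 2) := T.boxProd (⊤ : SimpleGraph (Fin 2))

/-- Every vertex of the edge `e` of the prism lies over `B`. -/
def Inside (B : Set V) (e : Sym2 (V × Fin 2)) : Prop := ∀ w ∈ e, w.1 ∈ B

/-- Some precolored edge lies over the branch at `x` away from `v`. -/
def Heavy (T : SimpleGraph V) (φ : Sym2 (V × Fin 2) → Option ℕ) (v x : V) : Prop :=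
  ∃ e, φ e ≠ none ∧ Inside (branch T v x) e

/-- The number of pairs of a projected edge and a color occurring on it; two copies of the same
edge with the same color are counted once. -/
noncomputable def weight (φ : Sym2 (V × Fin 2) → Option ℕ) : ℕ :=
  ((fun e => (e.map Prod.fst, φ e)) '' Precolored φ).ncard

open Classical in
/-- Erase the colors over the branch at `x` away from `v`, and color by `c` the uncolored copies
of the edge `vx`. -/
noncomputable def cut (T : SimpleGraph V) (φ : Sym2 (V × Fin 2) → Option ℕ) (v x : V) (c : ℕ) :
    Sym2 (V × Fin 2) → Option ℕ := fun e =>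
  if Inside (branch T v x) e then none
  else if φ e = none ∧ e ∈ (prism T).edgeSet ∧ e.map Prod.fst = s(v, x) then some c else φ e

variable {T : SimpleGraph V} {φ : Sym2 (V × Fin 2) → Option ℕ}

lemma EdgeAdj.exists_common {W : Type*} {G : SimpleGraph W} {e f : Sym2 W} (h : EdgeAdj G e f) :
    ∃ w p q, e = s(w, p) ∧ f = s(w, q) ∧ G.Adj w p ∧ G.Adj w q ∧ p ≠ q := by
  obtain ⟨he, hf, hne, w, hwe, hwf⟩ := h
  obtain ⟨p, rfl⟩ := Sym2.mem_iff_exists.1 hwe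
  obtain ⟨q, rfl⟩ := Sym2.mem_iff_exists.1 hwf
  exact ⟨w, p, q, rfl, rfl, he, hf, fun h => hne (by rw [h])⟩

lemma exists_unused_color [Finite V] {D : ℕ} (hw : weight φ ≤ D) :
    ∃ c < D + 1, ∀ e, φ e ≠ some c := by
  by_contra! h
  have : Nonempty (Sym2 (V × Fin 2)) := (h 0 (Nat.succ_pos D)).nonempty
  choose! g hg using h
  have h1 : (Set.Iio (D + 1)).ncard ≤ weight φ := by
    refine Set.ncard_le_ncard_of_injOn (fun c => ((g c).map Prod.fst, some c)) ?_ ?_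
      (Set.toFinite _)
    · intro c hc
      refine ⟨g c, ?_, ?_⟩
      · simp [Precolored, hg c hc]
      · simp [hg c hc]
    · intro c _ d _ hcd
      simpa using congrArg Prod.snd hcd
  have h2 : (Set.Iio (D + 1)).ncard = D + 1 := by
    rw [Set.ncard_eq_toFinset_card']
    simp
  omega

/-- If all precolored edges meet the fiber over a vertex, the rungs can all get the same color
and the two copies of the tree can be colored independently with the other colors. -/
lemma extendable_of_star [Fintype V] [DecidableRel T.Adj] (hT : T.IsTree) {D : ℕ}
    (hdeg : ∀ v, T.degree v ≤ D) (hφ : IsPartialProperEdgeColoring (prism T) φ)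
    (hc : UsesColors φ (D + 1)) (hw : weight φ ≤ D) {u : V}
    (hu : ∀ e, φ e ≠ none → ∃ w ∈ e, w.1 = u) : Extendable (prism T) φ (D + 1) := by
  classical
  obtain ⟨c₀, hc₀, hunused⟩ := exists_unused_color hw
  have hγ : ∃ γ < D + 1, (∀ c, φ s((u, 0), (u, 1)) = some c → c = γ) ∧
      ∀ a i, T.Adj u a → φ s((u, i), (a, i)) ≠ some γ := by
    cases hr : φ s((u, 0), (u, 1)) with
    | none => exact ⟨c₀, hc₀, by simp, fun a i _ => hunused _⟩
    | some c =>
      refine ⟨c, hc _ _ hr, by simp, fun a i ha hai => ?_⟩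
      refine hφ.2 (e := s((u, 0), (u, 1))) (f := s((u, i), (a, i))) ⟨?_, ?_, ?_, (u, i), ?_, ?_⟩
        (by simp [hr]) (hr.trans hai.symm)
      · simp [boxProd_adj]
      · simp [boxProd_adj, ha]
      · intro h
        have : (a, i) ∈ s((u, (0 : Fin 2)), (u, 1)) := by simp [h]
        rcases Sym2.mem_iff.1 this with h | h <;> exact ha.ne (congrArg Prod.fst h).symm
      · fin_cases i <;> simp
      · simp
  obtain ⟨γ, hγ, hrung, hcol⟩ := hγ
  set S := (Finset.range (D + 1)).erase γ with hSdef
  have hScard : S.card = D := by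
    rw [Finset.card_erase_of_mem (by simpa using hγ)]
    simp
  have hL := fun i : Fin 2 => hT.exists_edge_coloring_extending_star (S := S)
    (fun v => hScard.symm ▸ hdeg v) u (fun a => φ s((u, i), (a, i)))
    (by
      intro a b ha hb c h1 h2
      by_contra hab
      refine hφ.2 (e := s((u, i), (a, i))) (f := s((u, i), (b, i)))
        ⟨by simp [boxProd_adj, ha], by simp [boxProd_adj, hb], ?_, (u, i), by simp, by simp⟩
        (by simp [h1]) (h1.trans h2.symm)
      exact fun h => hab (congrArg Prod.fst (Sym2.congr_right.1 h)))
    (by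
      intro a ha c h1
      refine Finset.mem_erase.2 ⟨?_, Finset.mem_range.2 (hc _ _ h1)⟩
      rintro rfl
      exact hcol a i ha h1)
  choose L hLsymm hLS hLinj hLext using hL
  let C : Sym2 (V × Fin 2) → ℕ := Sym2.lift ⟨fun p q => if p.1 = q.1 then γ else
    if p.2 = q.2 ∧ T.Adj p.1 q.1 then L p.2 p.1 q.1 else 0, by
      rintro ⟨a, i⟩ ⟨b, j⟩
      have := hLsymm i a b
      have := T.adj_comm a b
      grind⟩
  have hC : ∀ p q, (prism T).Adj p q → (p.1 = q.1 ∧ p.2 ≠ q.2 ∧ C s(p, q) = γ) ∨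
      (T.Adj p.1 q.1 ∧ p.2 = q.2 ∧ C s(p, q) = L p.2 p.1 q.1) := by
    intro p q hpq
    rcases boxProd_adj.1 hpq with ⟨h1, h2⟩ | ⟨h1, h2⟩
    · exact Or.inr ⟨h1, h2, by simp [C, h1, h2, h1.ne]⟩
    · exact Or.inl ⟨h2, h1, by simp [C, h2]⟩
  refine ⟨C, ?_, ?_, ?_⟩
  · intro e f hef
    obtain ⟨w, p, q, rfl, rfl, hp, hq, hpq⟩ := hef.exists_common
    rcases hC w p hp with ⟨h1, h2, h3⟩ | ⟨h1, h2, h3⟩ <;>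
      rcases hC w q hq with ⟨h1', h2', h3'⟩ | ⟨h1', h2', h3'⟩ <;> rw [h3, h3']
    · exact absurd (Prod.ext (h1.symm.trans h1') (by omega)) hpq
    · exact fun h => (Finset.mem_erase.1 (hLS w.2 _ _ h1')).1 h.symm
    · exact fun h => (Finset.mem_erase.1 (hLS w.2 _ _ h1)).1 h
    · exact fun h => hpq (Prod.ext (hLinj w.2 w.1 h1 h1' h) (h2.symm.trans h2'))
  · intro e he
    induction e with | _ p q
    rcases hC p q he with ⟨_, _, h⟩ | ⟨h1, _, h⟩ <;> rw [h]
    · exact hγ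
    · exact Finset.mem_range.1 (Finset.mem_erase.1 (hLS p.2 _ _ h1)).2
  · intro e c he
    have hne : φ e ≠ none := by simp [he]
    obtain ⟨⟨a, i⟩, hwe, hwu⟩ := hu e hne
    obtain rfl : a = u := hwu
    obtain ⟨⟨b, j⟩, rfl⟩ := Sym2.mem_iff_exists.1 hwe
    rcases hC _ _ (hφ.1 _ hne) with ⟨h1, h2, h⟩ | ⟨h1, h2, h⟩ <;> rw [h]
    · obtain rfl : a = b := h1
      refine (hrung c ?_).symm
      rw [← he]
      fin_cases i <;> fin_cases j <;> simp_all [Sym2.eq_swap]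
    · obtain rfl : i = j := h2
      exact hLext i b h1 c he

lemma cut_eq_some {v x : V} {c d : ℕ} {e : Sym2 (V × Fin 2)} (h : cut T φ v x c e = some d) :
    ¬ Inside (branch T v x) e ∧
      (φ e = some d ∨ d = c ∧ φ e = none ∧ e ∈ (prism T).edgeSet ∧ e.map Prod.fst = s(v, x)) := by
  unfold cut at h
  grind

lemma cut_eq_of_eq_some {v x : V} {c d : ℕ} {e : Sym2 (V × Fin 2)}
    (hin : ¬ Inside (branch T v x) e) (h : φ e = some d) : cut T φ v x c e = some d := by
  simp [cut, hin, h]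

lemma not_inside_of_map_eq (B : Set V) {v x : V} {e : Sym2 (V × Fin 2)}
    (he : e.map Prod.fst = s(v, x)) (hv : v ∉ B) : ¬ Inside B e := by
  intro h
  obtain ⟨w, hw, rfl⟩ := Sym2.mem_map.1 (he ▸ Sym2.mem_mk_left v x)
  exact hv (h w hw)

lemma cut_isPartialProper (hφ : IsPartialProperEdgeColoring (prism T) φ) {v x : V}
    (hvx : T.Adj v x) {c : ℕ} (hc : ∀ e, φ e ≠ some c) :
    IsPartialProperEdgeColoring (prism T) (cut T φ v x c) := by
  constructor
  · intro e he
    obtain ⟨d, hd⟩ := Option.ne_none_iff_exists'.1 he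
    rcases (cut_eq_some hd).2 with h | h
    · exact hφ.1 e (by simp [h])
    · exact h.2.2.1
  · intro e f hef he heq
    obtain ⟨d, hd⟩ := Option.ne_none_iff_exists'.1 he
    rcases (cut_eq_some hd).2 with h | ⟨rfl, -, -, h⟩ <;>
      rcases (cut_eq_some (heq.symm.trans hd)).2 with h' | ⟨h1, -, -, h'⟩
    · exact hφ.2 hef (by simp [h]) (h.trans h'.symm)
    · exact hc e (h1 ▸ h)
    · exact hc f h'
    · obtain ⟨w, p, q, rfl, rfl, hp, hq, hpq⟩ := hef.exists_common
      simp only [Sym2.map_mk] at h h'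
      rw [boxProd_adj] at hp hq
      have := hvx.ne
      have : p.1 = q.1 := by grind
      have : w.1 ≠ p.1 := by grind
      have : w.1 ≠ q.1 := by grind
      exact hpq (Prod.ext ‹_› (by grind))

lemma weight_cut_le [Finite V] {v x : V} (c : ℕ) (h : Heavy T φ v x) :
    weight (cut T φ v x c) ≤ weight φ := by
  obtain ⟨e₀, he₀, hin⟩ := h
  set P := (fun e => (e.map Prod.fst, φ e)) '' Precolored φ with hP
  have hmem : (e₀.map Prod.fst, φ e₀) ∈ P := ⟨e₀, he₀, rfl⟩
  have hsub : (fun e => (e.map Prod.fst, cut T φ v x c e)) '' Precolored (cut T φ v x c) ⊆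
      insert (s(v, x), some c) (P \ {(e₀.map Prod.fst, φ e₀)}) := by
    rintro _ ⟨e, he, rfl⟩
    obtain ⟨d, hd⟩ := Option.ne_none_iff_exists'.1 he
    obtain ⟨hnin, h | ⟨rfl, -, -, h⟩⟩ := cut_eq_some hd
    · refine Or.inr ⟨⟨e, by simp [Precolored, h], by simp [h, hd]⟩, fun heq => hnin ?_⟩
      have hmap : e.map Prod.fst = e₀.map Prod.fst := congrArg Prod.fst heq
      intro w hw
      have : w.1 ∈ e₀.map Prod.fst := hmap ▸ Sym2.mem_map.2 ⟨w, hw, rfl⟩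
      obtain ⟨w', hw', hww'⟩ := Sym2.mem_map.1 this
      exact hww' ▸ hin w' hw'
    · exact Or.inl (by simp [h, hd])
  calc weight (cut T φ v x c)
      ≤ (insert (s(v, x), some c) (P \ {(e₀.map Prod.fst, φ e₀)})).ncard :=
        Set.ncard_le_ncard hsub (((Set.toFinite _).image _).sdiff.insert _)
    _ ≤ (P \ {(e₀.map Prod.fst, φ e₀)}).ncard + 1 := Set.ncard_insert_le _ _
    _ = weight φ := Set.ncard_sdiff_singleton_add_one hmem ((Set.toFinite _).image _)

lemma heavy_of_heavy_cut (hT : T.IsTree) {v x a b : V} {c : ℕ} (hvx : T.Adj v x)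
    (hheavy : Heavy T φ v x) (hab : T.Adj a b) (h : Heavy T (cut T φ v x c) a b)
    (h' : Heavy T (cut T φ v x c) b a) : Heavy T φ a b := by
  obtain ⟨e, he, hin⟩ := h
  obtain ⟨d, hd⟩ := Option.ne_none_iff_exists'.1 he
  rcases (cut_eq_some hd).2 with h | ⟨-, -, -, hmap⟩
  · exact ⟨e, by simp [h], hin⟩
  have hv : v ∈ branch T a b := by
    by_contra hv
    exact not_inside_of_map_eq _ hmap hv hin
  have hx : x ∈ branch T a b := by
    by_contra hx
    exact not_inside_of_map_eq _ (hmap.trans Sym2.eq_swap) hx hin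
  rcases hT.mem_branch_or hvx a with ha | ha
  · obtain ⟨f, hf, hfin⟩ := h'
    obtain ⟨d', hd'⟩ := Option.ne_none_iff_exists'.1 hf
    refine absurd (fun w hw => ?_) (cut_eq_some hd').1
    exact (hT.mem_branch_or hvx w.1).resolve_right fun hw' => notMem_branch_symm (hfin w hw)
      (hT.branch_subset_branch hvx.symm hab hx hv ha hw')
  · obtain ⟨f, hf, hfin⟩ := hheavy
    exact ⟨f, hf, fun w hw => hT.branch_subset_branch hvx hab hv hx ha (hfin w hw)⟩

/-- The edges of `T`, as ordered pairs, with precolored edges over both of their sides. -/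
def separatingPairs (T : SimpleGraph V) (φ : Sym2 (V × Fin 2) → Option ℕ) : Set (V × V) :=
  {p | T.Adj p.1 p.2 ∧ Heavy T φ p.1 p.2 ∧ Heavy T φ p.2 p.1}

lemma ncard_separatingPairs_cut_lt [Finite V] (hT : T.IsTree) {v x : V} (c : ℕ)
    (hvx : (v, x) ∈ separatingPairs T φ) :
    (separatingPairs T (cut T φ v x c)).ncard < (separatingPairs T φ).ncard := by
  refine Set.ncard_lt_ncard ⟨fun p hp => ?_, fun hsub => ?_⟩ (Set.toFinite _)
  · exact ⟨hp.1, heavy_of_heavy_cut hT hvx.1 hvx.2.1 hp.1 hp.2.1 hp.2.2,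
      heavy_of_heavy_cut hT hvx.1 hvx.2.1 hp.1.symm hp.2.2 hp.2.1⟩
  · obtain ⟨e, he, hin⟩ := (hsub hvx).2.1
    obtain ⟨d, hd⟩ := Option.ne_none_iff_exists'.1 he
    exact (cut_eq_some hd).1 hin

lemma UsesColors.cut {t : ℕ} (hc : UsesColors φ t) {v x : V} {c : ℕ} (hct : c < t) :
    UsesColors (cut T φ v x c) t := by
  intro e d hd
  rcases (cut_eq_some hd).2 with h | ⟨rfl, -⟩
  · exact hc e d h
  · exact hct

/-- Colorings of the two sides of a cut agree on the cut edges and can be glued. -/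
lemma extendable_of_cut (hT : T.IsTree) {v x : V} (hvx : T.Adj v x) {c t : ℕ}
    (h₁ : Extendable (prism T) (cut T φ v x c) t)
    (h₂ : Extendable (prism T) (cut T φ x v c) t) : Extendable (prism T) φ t := by
  classical
  obtain ⟨C₁, hp₁, hb₁, he₁⟩ := h₁
  obtain ⟨C₂, hp₂, hb₂, he₂⟩ := h₂
  have hagree : ∀ e ∈ (prism T).edgeSet, e.map Prod.fst = s(v, x) → C₁ e = C₂ e := by
    intro e he hmap
    have hin₁ : ¬ Inside (branch T v x) e :=
      not_inside_of_map_eq _ hmap (notMem_branch_symm (hT.mem_branch_right hvx.symm))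
    have hin₂ : ¬ Inside (branch T x v) e := not_inside_of_map_eq _ (hmap.trans Sym2.eq_swap)
      (notMem_branch_symm (hT.mem_branch_right hvx))
    cases h : φ e with
    | none =>
      rw [he₁ e c (by simp only [cut]; rw [if_neg hin₁, if_pos ⟨h, he, hmap⟩]),
        he₂ e c (by simp only [cut]; rw [if_neg hin₂, if_pos ⟨h, he, hmap.trans Sym2.eq_swap⟩])]
    | some d => rw [he₁ e d (cut_eq_of_eq_some hin₁ h), he₂ e d (cut_eq_of_eq_some hin₂ h)]
  have hcross : ∀ e f, EdgeAdj (prism T) e f → Inside (branch T v x) e →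
      ¬ Inside (branch T v x) f → C₂ e ≠ C₁ f := by
    intro e f hef hine hinf
    rw [hagree f hef.2.1]
    · exact hp₂ hef
    · obtain ⟨w, p, q, rfl, rfl, hp, hq, hpq⟩ := hef.exists_common
      have hw : w.1 ∈ branch T v x := hine w (by simp)
      have hq' : q.1 ∉ branch T v x := fun h => hinf fun z hz => by
        rcases Sym2.mem_iff.1 hz with rfl | rfl <;> assumption
      rcases boxProd_adj.1 hq with ⟨h1, h2⟩ | ⟨h1, h2⟩
      · obtain ⟨h3, h4⟩ := hT.eq_of_adj_branch hvx h1 hw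
          ((hT.mem_branch_or hvx q.1).resolve_left hq')
        simp [h3, h4, Sym2.eq_swap]
      · exact absurd (h2 ▸ hw) hq'
  refine ⟨fun e => if Inside (branch T v x) e then C₂ e else C₁ e, ?_, ?_, ?_⟩
  · intro e f hef
    have hfe : EdgeAdj (prism T) f e :=
      ⟨hef.2.1, hef.1, hef.2.2.1.symm, hef.2.2.2.imp fun _ h => h.symm⟩
    by_cases h : Inside (branch T v x) e <;> by_cases h' : Inside (branch T v x) f <;>
      simp only [h, h', if_true, if_false]
    · exact hp₂ hef
    · exact hcross e f hef h h'
    · exact (hcross f e hfe h' h).symm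
    · exact hp₁ hef
  · intro e he
    dsimp only
    split_ifs
    · exact hb₂ e he
    · exact hb₁ e he
  · intro e a hea
    dsimp only
    split_ifs with h
    · refine he₂ e a (cut_eq_of_eq_some (fun h' => ?_) hea)
      induction e with | _ p q
      exact notMem_branch_symm (h p (by simp)) (h' p (by simp))
    · exact he₁ e a (cut_eq_of_eq_some h hea)

/-- If no edge separates the precolored edges, they all meet the fiber over one vertex. -/
lemma exists_star_of_separatingPairs_eq_empty [Finite V] (hT : T.IsTree)
    (hφ : IsPartialProperEdgeColoring (prism T) φ) (h : separatingPairs T φ = ∅) :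
    ∃ u, ∀ e, φ e ≠ none → ∃ w ∈ e, w.1 = u := by
  have hsink : ∃ u, ∀ y, T.Adj u y → ¬ Heavy T φ u y := by
    by_cases hne : {p : V × V | T.Adj p.1 p.2 ∧ Heavy T φ p.1 p.2}.Nonempty
    · obtain ⟨⟨v, x⟩, ⟨hvx, hheavy⟩, hmin⟩ := Set.exists_min_image _
        (fun p : V × V => (branch T p.1 p.2).ncard) (Set.toFinite _) hne
      refine ⟨x, fun y hxy hy => ?_⟩
      by_cases hyv : y = v
      · subst hyv
        exact Set.eq_empty_iff_forall_notMem.1 h (y, x) ⟨hvx, hheavy, hy⟩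
      · exact absurd (hmin (x, y) ⟨hxy, hy⟩)
          (not_le.2 (Set.ncard_lt_ncard (hT.branch_ssubset hvx hxy hyv) (Set.toFinite _)))
    · obtain ⟨u⟩ := hT.connected.nonempty
      exact ⟨u, fun y h1 h2 => hne ⟨(u, y), h1, h2⟩⟩
  obtain ⟨u, hu⟩ := hsink
  refine ⟨u, fun e he => ?_⟩
  by_contra! hnot
  induction e with | _ p q
  have hpu : u ≠ p.1 := (hnot p (by simp)).symm
  obtain ⟨y, huy, hd⟩ := hT.exists_adj_dist_succ hpu
  have hp : p.1 ∈ branch T u y := by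
    rw [mem_branch]
    omega
  refine hu y huy ⟨s(p, q), he, fun w hw => ?_⟩
  rcases Sym2.mem_iff.1 hw with rfl | rfl
  · exact hp
  · rcases boxProd_adj.1 (hφ.1 _ he) with ⟨h1, -⟩ | ⟨-, h2⟩
    · by_contra hq
      exact hnot w (by simp) (hT.eq_of_adj_branch huy h1 hp
        ((hT.mem_branch_or huy _).resolve_left hq)).2
    · exact h2 ▸ hp

/-- A partial proper coloring of the prism over a tree with maximum degree at most `D` extends to
`D + 1` colors if its weight is at most `D`. -/
lemma extendable_of_weight_le [Fintype V] [DecidableRel T.Adj] (hT : T.IsTree) {D : ℕ}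
    (hdeg : ∀ v, T.degree v ≤ D) (φ : Sym2 (V × Fin 2) → Option ℕ)
    (hφ : IsPartialProperEdgeColoring (prism T) φ) (hc : UsesColors φ (D + 1))
    (hw : weight φ ≤ D) : Extendable (prism T) φ (D + 1) := by
  induction hn : (separatingPairs T φ).ncard using Nat.strong_induction_on generalizing φ with
  | _ n ih =>
    subst hn
    rcases Set.eq_empty_or_nonempty (separatingPairs T φ) with h | ⟨⟨v, x⟩, hvx⟩
    · obtain ⟨u, hu⟩ := exists_star_of_separatingPairs_eq_empty hT hφ h
      exact extendable_of_star hT hdeg hφ hc hw hu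
    · obtain ⟨c, hcD, hunused⟩ := exists_unused_color hw
      have hstep : ∀ {a b}, (a, b) ∈ separatingPairs T φ →
          Extendable (prism T) (cut T φ a b c) (D + 1) := fun {a b} hab =>
        ih _ (ncard_separatingPairs_cut_lt hT c hab) _ (cut_isPartialProper hφ hab.1 hunused)
          (hc.cut hcD) ((weight_cut_le c hab.2.1).trans hw) rfl
      exact extendable_of_cut hT hvx.1 (hstep hvx) (hstep ⟨hvx.1.symm, hvx.2.2, hvx.2.1⟩)

end Prism

theorem stmt7 [Fintype V] (T : SimpleGraph V) [DecidableRel T.Adj] (hT : T.IsTree)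
    (φ : Sym2 (V × Fin 2) → Option ℕ)
    (hφ : IsPartialProperEdgeColoring (T.boxProd (⊤ : SimpleGraph (Fin 2))) φ)
    (hc : UsesColors φ T.maxDegree)
    (hcard : (Precolored φ).ncard ≤ T.maxDegree) :
    Extendable (T.boxProd (⊤ : SimpleGraph (Fin 2))) φ (T.maxDegree + 1) := by
  exact extendable_of_weight_le hT T.degree_le_maxDegree φ hφ
    (fun e a h => (hc e a h).trans (Nat.lt_succ_self _))
    ((Set.ncard_image_le (Set.toFinite _)).trans hcard)
end

section
/- Let n ≥ 2. If φ is a partial proper edge coloring of at most n edges of K_{n,n} □ K_2 using colors {1,...,n}, then φ can be extended to a proper (n+1)-edge coloring of K_{n,n} □ K_2. -/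
open SimpleGraph

variable {V : Type*}

open Finset
theorem exists_injective_avoiding {n : ℕ} (Bl : Fin n → Fin n → Prop) (a : ℕ)
    (hrow : ∀ i (s : Finset (Fin n)), (∀ j ∈ s, Bl i j) → #s ≤ a)
    (hcol : ∀ j (s : Finset (Fin n)), (∀ i ∈ s, Bl i j) → #s ≤ a)
    (F : Finset (Fin n × Fin n))
    (hF1 : Set.InjOn Prod.fst (F : Set (Fin n × Fin n)))
    (hF2 : Set.InjOn Prod.snd (F : Set (Fin n × Fin n)))
    (hFB : ∀ t ∈ F, ¬ Bl t.1 t.2) (hcard : #F + 2 * a ≤ n) :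
    ∃ σ : Fin n → Fin n, Function.Injective σ ∧ (∀ t ∈ F, σ t.1 = t.2) ∧ ∀ i, ¬ Bl i (σ i) := by
  classical
  let ι := {i : Fin n // i ∉ F.image Prod.fst}
  let t : ι → Finset (Fin n) := fun i => {j | ¬ Bl i j ∧ j ∉ F.image Prod.snd}
  have hι : Fintype.card ι = n - #F := by
    rw [Fintype.card_subtype_compl, Fintype.card_fin, Fintype.card_coe,
      card_image_of_injOn hF1]
  have hall : ∀ s : Finset ι, #s ≤ #(s.biUnion t) := by
    intro s
    by_contra! hlt
    have hs : #s ≤ n - #F := hι ▸ card_le_univ s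
    obtain ⟨i, hi⟩ : s.Nonempty := card_pos.1 (by omega)
    let U : Finset (Fin n) := (F.image Prod.snd)ᶜ \ s.biUnion t
    have hU : n - #F - #(s.biUnion t) ≤ #U := by
      have := le_card_sdiff (s.biUnion t) (F.image Prod.snd)ᶜ
      rwa [card_compl, Fintype.card_fin, card_image_of_injOn hF2] at this
    have hUB : ∀ j ∈ U, ∀ i ∈ s, Bl i j := by
      intro j hj i hi
      by_contra hb
      simp only [U, mem_sdiff, mem_compl, mem_biUnion, not_exists, not_and] at hj
      exact hj.2 i hi (by simp only [t, mem_filter]; exact ⟨mem_univ _, hb, hj.1⟩)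
    have h1 := hrow i U (fun j hj => hUB j hj i hi)
    obtain ⟨j, hj⟩ : U.Nonempty := card_pos.1 (by omega)
    have h2 := hcol j (s.map (Function.Embedding.subtype _)) (by
      intro k hk
      obtain ⟨k', hk', rfl⟩ := mem_map.1 hk
      exact hUB j hj k' hk')
    rw [card_map] at h2
    omega
  obtain ⟨e, he, het⟩ := (all_card_le_biUnion_card_iff_exists_injective t).1 hall
  have het' : ∀ i : ι, ¬ Bl i (e i) ∧ e i ∉ F.image Prod.snd := fun i => by
    simpa only [t, mem_filter, mem_univ, true_and] using het i
  have hex : ∀ i, i ∈ F.image Prod.fst → ∃ j, (i, j) ∈ F := by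
    intro i hi; simpa using hi
  choose! f hf using hex
  have hfu : ∀ x ∈ F, f x.1 = x.2 := fun x hx =>
    congrArg Prod.snd (hF1 (hf x.1 (mem_image_of_mem _ hx)) hx rfl)
  refine ⟨fun i => if h : i ∈ F.image Prod.fst then f i else e ⟨i, h⟩, ?_, ?_, ?_⟩
  · intro i i' h
    by_cases h1 : i ∈ F.image Prod.fst <;> by_cases h2 : i' ∈ F.image Prod.fst <;>
      simp only [h1, h2, dif_pos, dif_neg, not_false_eq_true] at h
    · exact congrArg Prod.fst (hF2 (hf i h1) (hf i' h2) h)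
    · exact absurd (mem_image_of_mem Prod.snd (hf i h1)) (h ▸ (het' ⟨i', h2⟩).2)
    · exact absurd (mem_image_of_mem Prod.snd (hf i' h2)) (h ▸ (het' ⟨i, h1⟩).2)
    · exact congrArg Subtype.val (he h)
  · intro x hx
    simp only [mem_image_of_mem Prod.fst hx, dif_pos, hfu x hx]
  · intro i
    by_cases h : i ∈ F.image Prod.fst
    · simpa only [h, dif_pos] using hFB _ (hf i h)
    · simpa only [h, dif_neg, not_false_eq_true] using (het' ⟨i, h⟩).1

theorem exists_injective_avoiding_of_regular {n : ℕ} (D : Finset (Fin n))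
    (σ : Fin n → Fin n → Fin n) (hD : #D < n)
    (hinj : ∀ d ∈ D, Function.Injective (σ d))
    (hdis : ∀ d ∈ D, ∀ d' ∈ D, ∀ i, σ d i = σ d' i → d = d') :
    ∃ τ : Fin n → Fin n, Function.Injective τ ∧ ∀ d ∈ D, ∀ i, σ d i ≠ τ i := by
  classical
  have hsurj : ∀ d ∈ D, ∀ j, ∃ i, σ d i = j := fun d hd =>
    Finite.surjective_of_injective (hinj d hd)
  choose! g hg using hsurj
  let t : Fin n → Finset (Fin n) := fun i => (D.image (σ · i))ᶜ
  have hall : ∀ s : Finset (Fin n), #s ≤ #(s.biUnion t) := by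
    intro s
    have key := card_mul_le_card_mul (s := s) (t := s.biUnion t) (m := n - #D) (n := n - #D)
      (fun i j => j ∈ t i) ?_ ?_
    · exact Nat.le_of_mul_le_mul_right key (by omega)
    · intro i hi
      have : bipartiteAbove (fun i j => j ∈ t i) (s.biUnion t) i = t i := by
        ext j
        simp only [mem_bipartiteAbove, mem_biUnion]
        exact ⟨fun h => h.2, fun h => ⟨⟨i, hi, h⟩, h⟩⟩
      rw [this, card_compl, Fintype.card_fin,
        card_image_of_injOn (fun d hd d' hd' h => hdis d hd d' hd' i h)]
    · intro j _
      have hsub : bipartiteBelow (fun i j => j ∈ t i) s j ⊆ (D.image fun d => g d j)ᶜ := by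
        intro i hi
        simp only [mem_bipartiteBelow, t, mem_compl, mem_image, not_exists, not_and] at hi
        simp only [mem_compl, mem_image, not_exists, not_and]
        rintro d hd rfl
        exact hi.2 d hd (hg d hd j)
      refine (card_le_card hsub).trans ?_
      rw [card_compl, Fintype.card_fin, card_image_of_injOn]
      intro d hd d' hd' h
      refine hdis d hd d' hd' (g d j) ?_
      simp only at h
      rw [hg d hd j, h, hg d' hd' j]
  obtain ⟨τ, hτ, hτt⟩ := (all_card_le_biUnion_card_iff_exists_injective t).1 hall
  refine ⟨τ, hτ, fun d hd i h => ?_⟩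
  have := hτt i
  simp only [t, mem_compl, mem_image, not_exists, not_and] at this
  exact this d hd h

theorem exists_exchange {ι : Type} [DecidableEq ι] (R : Finset ι) (u t : ι → ℕ) (x : ℕ)
    (hu : Set.InjOn u R) (ht : Set.InjOn t R) (hx : ∀ i ∈ R, t i ≠ x) :
    ∃ (β u' : ι → ℕ) (w : ℕ),
      (∀ i ∈ R, (β i = u i ∧ u' i = t i) ∨ (β i = t i ∧ u' i = u i)) ∧
      Set.InjOn β R ∧ (∀ i ∈ R, β i ≠ w) ∧
      (∀ i ∈ R, β i = x ∨ ∃ k ∈ R, β i = t k) ∧ (w = x ∨ ∃ k ∈ R, w = t k) ∧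
      (∀ i ∈ R, u i ≠ w) ∧ Set.InjOn u' R ∧ (∀ i ∈ R, u' i ≠ x) ∧
      (∀ i ∈ R, u i = x ∨ ∃ k ∈ R, u i = u' k) ∧ (w = x ∨ ∃ k ∈ R, w = u' k) := by
  induction R using Finset.strongInduction generalizing x with
  | H R ih =>
  by_cases h : ∃ i ∈ R, u i = x
  · obtain ⟨i, hi, hix⟩ := h
    have hmem : ∀ k, k ∈ R.erase i ↔ k ≠ i ∧ k ∈ R := fun k => Finset.mem_erase
    obtain ⟨β, u', w, h1, h2, h3, h4, h5, h6, h7, h8, h9, h10⟩ := ih (R.erase i)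
      (Finset.erase_ssubset hi) (t i) (hu.mono (by simp)) (ht.mono (by simp))
      (fun k hk e => (hmem k).1 hk |>.1 (ht ((hmem k).1 hk).2 hi e))
    have hmem' : ∀ k ∈ R, k = i ∨ k ∈ R.erase i := fun k hk => by
      rw [hmem]; tauto
    have hsub : ∀ k ∈ R.erase i, k ∈ R ∧ k ≠ i := fun k hk => by rw [hmem] at hk; tauto
    have hwx : w ≠ x := by grind
    have hux : ∀ k ∈ R.erase i, u' k ≠ x := by
      intro k hk e
      rcases h1 k hk with ⟨-, h⟩ | ⟨-, h⟩
      · exact hx k (hsub k hk).1 (h ▸ e)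
      · exact (hsub k hk).2 (hu (hsub k hk).1 hi (by grind))
    have hbx : ∀ k ∈ R.erase i, β k ≠ x := by grind
    refine ⟨Function.update β i x, Function.update u' i (t i), w, ?_, ?_, ?_, ?_, ?_, ?_, ?_, ?_,
      ?_, ?_⟩
    · grind
    · intro a ha b hb
      rcases hmem' a ha with rfl | ha' <;> rcases hmem' b hb with rfl | hb' <;>
        intro e
      · rfl
      · grind
      · grind
      · exact h2 ha' hb' (by grind)
    · grind
    · grind
    · grind
    · grind
    · intro a ha b hb
      rcases hmem' a ha with rfl | ha' <;> rcases hmem' b hb with rfl | hb' <;>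
        intro e
      · rfl
      · grind
      · grind
      · exact h7 ha' hb' (by grind)
    · grind
    · intro k hk
      rcases hmem' k hk with rfl | hk'
      · exact Or.inl hix
      · right
        rcases h9 k hk' with e | ⟨l, hl, e⟩
        · exact ⟨i, hi, by simp [e]⟩
        · exact ⟨l, (hsub l hl).1, by grind⟩
    · right
      rcases h10 with e | ⟨l, hl, e⟩
      · exact ⟨i, hi, by simp [e]⟩
      · exact ⟨l, (hsub l hl).1, by grind⟩
  · push Not at h
    exact ⟨t, u, x, by simp, ht, hx, fun i hi => .inr ⟨i, hi, rfl⟩, .inl rfl, h, hu, h,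
      fun i hi => .inr ⟨i, hi, rfl⟩, .inl rfl⟩

/-- A partial Latin square of order `n`, as a set of (row, column, symbol) triples. If `sp` holds,
then symbols may be repeated in row `0` and in column `0`, and the corner cell is left empty. -/
structure IsPartialSquare (sp : Prop) {n : ℕ} (P : Finset (Fin n × Fin n × Fin n)) : Prop where
  cell : ∀ s ∈ P, ∀ t ∈ P, s.1 = t.1 → s.2.1 = t.2.1 → s = t
  row : ∀ s ∈ P, ∀ t ∈ P, s.1 = t.1 → s.2.2 = t.2.2 → (sp → s.1.val ≠ 0) → s = t
  col : ∀ s ∈ P, ∀ t ∈ P, s.2.1 = t.2.1 → s.2.2 = t.2.2 → (sp → s.2.1.val ≠ 0) → s = t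
  corner : ∀ s ∈ P, sp → s.1.val ≠ 0 ∨ s.2.1.val ≠ 0

/-- `P` extends to a full square. If `sp` holds, then symbols may be repeated in row `0` and in
column `0`. -/
def IsCompletable (sp : Prop) {n : ℕ} (P : Finset (Fin n × Fin n × Fin n)) : Prop :=
  ∃ L : Fin n → Fin n → Fin n,
    (∀ i, (sp → i.val ≠ 0) → Function.Injective (L i)) ∧
    (∀ j, (sp → j.val ≠ 0) → Function.Injective fun i => L i j) ∧
    ∀ t ∈ P, L t.1 t.2.1 = t.2.2

theorem isCompletable_of_no_singleton {n : ℕ} (P : Finset (Fin n × Fin n × Fin n))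
    (hP : IsPartialSquare False P) (hcard : #P ≤ n)
    (hsing : ∀ k, #{t ∈ P | t.2.2 = k} ≠ 1) : IsCompletable False P := by
  classical
  set D : Finset (Fin n) := P.image fun t => t.2.2 with hDdef
  have hsize : ∀ l ∈ D, #{t ∈ P | t.2.2 = l} + 2 * (#D - 1) ≤ n := by
    intro l hl
    have h1 : #P = ∑ k ∈ D, #{t ∈ P | t.2.2 = k} :=
      card_eq_sum_card_fiberwise fun t ht => mem_image_of_mem _ ht
    rw [← add_sum_erase D _ hl] at h1
    have h2 : #(D.erase l) • 2 ≤ ∑ k ∈ D.erase l, #{t ∈ P | t.2.2 = k} := by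
      refine card_nsmul_le_sum _ _ _ fun k hk => ?_
      obtain ⟨t, ht, htk⟩ := mem_image.1 (mem_of_mem_erase hk)
      have : 0 < #{t ∈ P | t.2.2 = k} := card_pos.2 ⟨t, mem_filter.2 ⟨ht, htk⟩⟩
      have := hsing k
      omega
    rw [card_erase_of_mem hl, smul_eq_mul] at h2
    omega
  have main : ∀ D' ⊆ D, ∃ σ : Fin n → Fin n → Fin n,
      (∀ d ∈ D', Function.Injective (σ d)) ∧
      (∀ d ∈ D', ∀ t ∈ P, t.2.2 = d → σ d t.1 = t.2.1) ∧
      (∀ d ∈ D', ∀ t ∈ P, t.2.2 ≠ d → σ d t.1 ≠ t.2.1) ∧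
      (∀ d ∈ D', ∀ d' ∈ D', ∀ i, σ d i = σ d' i → d = d') := by
    intro D' hD'
    induction D' using Finset.induction_on with
    | empty => exact ⟨fun _ => id, by simp, by simp, by simp, by simp⟩
    | insert l D' hl ih =>
      obtain ⟨σ, h1, h2, h3, h4⟩ := ih ((subset_insert _ _).trans hD')
      have hlD : l ∈ D := hD' (mem_insert_self _ _)
      let B : Fin n → Fin n → Fin n → Prop := fun d i j =>
        d ≠ l ∧ (d ∈ D' ∧ σ d i = j ∨ (i, j, d) ∈ P)
      have hB1 : ∀ d i j j', B d i j → B d i j' → j = j' := by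
        rintro d i j j' ⟨-, ⟨hd, rfl⟩ | h⟩ ⟨-, ⟨hd', rfl⟩ | h'⟩
        · rfl
        · exact h2 d hd _ h' rfl
        · exact (h2 d hd' _ h rfl).symm
        · exact congrArg (·.2.1) (hP.row _ h _ h' rfl rfl False.elim)
      have hB2 : ∀ d i i' j, B d i j → B d i' j → i = i' := by
        rintro d i i' j ⟨-, ⟨hd, rfl⟩ | h⟩ ⟨-, ⟨hd', h''⟩ | h'⟩
        · exact (h1 d hd h'').symm
        · exact (h1 d hd (h2 d hd _ h' rfl)).symm
        · exact (h1 d hd' (h''.trans (h2 d hd' _ h rfl).symm)).symm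
        · exact congrArg (·.1) (hP.col _ h _ h' rfl rfl False.elim)
      have hBD : ∀ d i j, B d i j → d ∈ D.erase l := by
        rintro d i j ⟨hd, ⟨hd', -⟩ | h⟩
        · exact mem_erase.2 ⟨hd, hD' (mem_insert_of_mem hd')⟩
        · exact mem_erase.2 ⟨hd, mem_image_of_mem (fun t : Fin n × Fin n × Fin n => t.2.2) h⟩
      have hbound : ∀ (s : Finset (Fin n)) (f : Fin n → Fin n),
          (∀ j ∈ s, f j ∈ D.erase l) → Set.InjOn f s → #s ≤ #D - 1 := by
        intro s f hf hfs
        rw [← card_erase_of_mem hlD]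
        exact card_le_card_of_injOn f hf hfs
      obtain ⟨τ, hτ, hτF, hτB⟩ := exists_injective_avoiding (fun i j => ∃ d, B d i j) (#D - 1)
        (by
          intro i s hs
          choose! f hf using hs
          refine hbound s f (fun j hj => hBD _ _ _ (hf j hj)) fun j hj j' hj' h => ?_
          exact hB1 _ _ _ _ (hf j hj) (h ▸ hf j' hj'))
        (by
          intro j s hs
          choose! f hf using hs
          refine hbound s f (fun i hi => hBD _ _ _ (hf i hi)) fun i hi i' hi' h => ?_
          exact hB2 _ _ _ _ (hf i hi) (h ▸ hf i' hi'))
        ({t ∈ P | t.2.2 = l}.image fun t => (t.1, t.2.1))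
        (by
          intro x hx y hy h
          simp only [coe_image, Set.mem_image, mem_coe, mem_filter] at hx hy
          obtain ⟨s, ⟨hs, hsl⟩, rfl⟩ := hx
          obtain ⟨t, ⟨ht, htl⟩, rfl⟩ := hy
          rw [hP.row s hs t ht h (hsl.trans htl.symm) False.elim])
        (by
          intro x hx y hy h
          simp only [coe_image, Set.mem_image, mem_coe, mem_filter] at hx hy
          obtain ⟨s, ⟨hs, hsl⟩, rfl⟩ := hx
          obtain ⟨t, ⟨ht, htl⟩, rfl⟩ := hy
          rw [hP.col s hs t ht h (hsl.trans htl.symm) False.elim])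
        (by
          intro x hx
          simp only [mem_image, mem_filter] at hx
          obtain ⟨s, ⟨hs, hsl⟩, rfl⟩ := hx
          rintro ⟨d, hd, ⟨hd', h⟩ | h⟩
          · exact h3 d hd' s hs (fun e => hd (e.symm.trans hsl)) h
          · exact hd ((congrArg (·.2.2) (hP.cell _ h s hs rfl rfl)).trans hsl))
        ((Nat.add_le_add_right card_image_le _).trans (hsize l hlD))
      refine ⟨Function.update σ l τ, ?_, ?_, ?_, ?_⟩
      · intro d hd
        rcases eq_or_ne d l with rfl | hdl
        · simpa using hτ
        · simpa [hdl] using h1 d (mem_of_mem_insert_of_ne hd hdl)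
      · intro d hd t ht htd
        rcases eq_or_ne d l with rfl | hdl
        · simpa using hτF (t.1, t.2.1) (mem_image.2 ⟨t, mem_filter.2 ⟨ht, htd⟩, rfl⟩)
        · simpa [hdl] using h2 d (mem_of_mem_insert_of_ne hd hdl) t ht htd
      · intro d hd t ht htd
        rcases eq_or_ne d l with rfl | hdl
        · simp only [Function.update_self]
          exact fun h => hτB t.1 ⟨t.2.2, htd, .inr (by rw [h]; exact ht)⟩
        · simpa [hdl] using h3 d (mem_of_mem_insert_of_ne hd hdl) t ht htd
      · intro d hd d' hd' i h
        by_cases hdl : d = l <;> by_cases hdl' : d' = l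
        · exact hdl.trans hdl'.symm
        · subst hdl
          simp only [Function.update_self, Function.update_of_ne hdl'] at h
          exact absurd ⟨d', hdl', .inl ⟨mem_of_mem_insert_of_ne hd' hdl', h.symm⟩⟩ (hτB i)
        · subst hdl'
          simp only [Function.update_self, Function.update_of_ne hdl] at h
          exact absurd ⟨d, hdl, .inl ⟨mem_of_mem_insert_of_ne hd hdl, h⟩⟩ (hτB i)
        · simp only [Function.update_of_ne hdl, Function.update_of_ne hdl'] at h
          exact h4 d (mem_of_mem_insert_of_ne hd hdl) d' (mem_of_mem_insert_of_ne hd' hdl') i h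
  have fill : ∀ E : Finset (Fin n), ∃ σ : Fin n → Fin n → Fin n,
      (∀ d ∈ D ∪ E, Function.Injective (σ d)) ∧
      (∀ d ∈ D, ∀ t ∈ P, t.2.2 = d → σ d t.1 = t.2.1) ∧
      (∀ d ∈ D ∪ E, ∀ d' ∈ D ∪ E, ∀ i, σ d i = σ d' i → d = d') := by
    intro E
    induction E using Finset.induction_on with
    | empty =>
      obtain ⟨σ, h1, h2, -, h4⟩ := main D subset_rfl
      exact ⟨σ, by simpa using h1, h2, by simpa using h4⟩
    | insert l E hl ih =>
      obtain ⟨σ, h1, h2, h3⟩ := ih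
      rw [union_insert]
      by_cases hlD : l ∈ D ∪ E
      · rw [insert_eq_of_mem hlD]
        exact ⟨σ, h1, h2, h3⟩
      obtain ⟨τ, hτ, hτσ⟩ := exists_injective_avoiding_of_regular (D ∪ E) σ
        (by simpa using card_lt_univ_of_notMem hlD) h1 h3
      refine ⟨Function.update σ l τ, ?_, ?_, ?_⟩
      · intro d hd
        rcases eq_or_ne d l with rfl | hdl
        · simpa using hτ
        · simpa [hdl] using h1 d (mem_of_mem_insert_of_ne hd hdl)
      · intro d hd t ht htd
        have hdl : d ≠ l := fun e => hlD (mem_union_left _ (e ▸ hd))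
        simpa [hdl] using h2 d hd t ht htd
      · intro d hd d' hd' i h
        by_cases hdl : d = l <;> by_cases hdl' : d' = l
        · exact hdl.trans hdl'.symm
        · subst hdl
          simp only [Function.update_self, Function.update_of_ne hdl'] at h
          exact absurd h.symm (hτσ d' (mem_of_mem_insert_of_ne hd' hdl') i)
        · subst hdl'
          simp only [Function.update_self, Function.update_of_ne hdl] at h
          exact absurd h (hτσ d (mem_of_mem_insert_of_ne hd hdl) i)
        · simp only [Function.update_of_ne hdl, Function.update_of_ne hdl'] at h
          exact h3 d (mem_of_mem_insert_of_ne hd hdl) d' (mem_of_mem_insert_of_ne hd' hdl') i h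
  obtain ⟨σ, h1, h2, h3⟩ := fill univ
  simp only [mem_union, mem_univ, or_true, true_implies] at h1 h3
  have hsurj : ∀ i j, ∃ d, σ d i = j := fun i =>
    Finite.surjective_of_injective fun d d' h => h3 d d' i h
  choose L hL using hsurj
  refine ⟨L, fun i _ j j' h => ?_, fun j _ i i' h => ?_, fun t ht => ?_⟩
  · rw [← hL i j, h, hL i j']
  · simp only at h
    refine h1 (L i j) ?_
    rw [hL i j, h, hL i' j]
  · refine h3 _ _ t.1 ?_
    rw [hL, h2 t.2.2 (mem_image_of_mem _ ht) t ht rfl]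

theorem smetaniuk {N : ℕ} (hN : 1 ≤ N) (T : ℕ → ℕ → ℕ) (hT : ∀ i < N, ∀ j < N, T i j < N)
    (hrow : ∀ i < N, 1 ≤ i → ∀ j < N, ∀ j' < N, T i j = T i j' → j = j')
    (hcol : ∀ j < N, 1 ≤ j → ∀ i < N, ∀ i' < N, T i j = T i' j → i = i') :
    ∃ L : ℕ → ℕ → ℕ, (∀ i j, i + j < N → L i j = T i j) ∧ (∀ i j, i + j = N → L i j = N) ∧
      (∀ i ≤ N, 1 ≤ i → ∀ j ≤ N, ∀ j' ≤ N, L i j = L i j' → j = j') ∧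
      (∀ j ≤ N, 1 ≤ j → ∀ i ≤ N, ∀ i' ≤ N, L i j = L i' j → i = i') ∧
      ∀ i ≤ N, ∀ j ≤ N, L i j ≤ N := by
  have main : ∀ k, 1 ≤ k → k ≤ N → ∃ (L : ℕ → ℕ → ℕ) (u : ℕ → ℕ),
      (∀ j < k, ∀ i, i + j < N → L i j = T i j) ∧
      (∀ j < k, ∀ i, i + j = N → L i j = N) ∧
      (∀ i ≤ N, 1 ≤ i → ∀ j < k, ∀ j' < k, L i j = L i j' → j = j') ∧
      (∀ j < k, 1 ≤ j → ∀ i ≤ N, ∀ i' ≤ N, L i j = L i' j → i = i') ∧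
      (∀ i ≤ N, ∀ j < k, L i j ≤ N) ∧
      (∀ i < N, N < i + k → ∃ j < k, u i = T i j) ∧
      (∀ i < N, N < i + k → ∀ j < k, L i j = N ∨ (∃ j' < k, L i j = T i j') ∧ L i j ≠ u i) ∧
      (∀ i < N, N < i + k → ∀ i' < N, N < i' + k → u i = u i' → i = i') ∧
      (∀ j < k, L N j = N ∨ ∃ i < N, N < i + k ∧ L N j = u i) := by
    intro k hk
    induction k, hk using Nat.le_induction with
    | base =>
      intro _
      refine ⟨fun i _ => if i < N then T i 0 else N, fun _ => 0, ?_, ?_, ?_, ?_, ?_, ?_, ?_, ?_, ?_⟩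
      all_goals grind
    | succ k hk ih =>
      intro hkN
      obtain ⟨L, u, h1, h2, h3, h4, h5, h6, h7, h8, h9⟩ := ih (by omega)
      have memR : ∀ i, i ∈ Finset.Ioo (N - k) N ↔ i < N ∧ N < i + k := by
        intro i; rw [Finset.mem_Ioo]; omega
      obtain ⟨β, u', w, e1, e2, e3, e4, e5, e6, e7, e8, e9, e10⟩ :=
        exists_exchange (Finset.Ioo (N - k) N) u (fun i => T i k) (T (N - k) k)
          (fun i hi i' hi' h => by
            have hi := (memR i).1 hi
            have hi' := (memR i').1 hi'
            exact h8 i hi.1 hi.2 i' hi'.1 hi'.2 h)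
          (fun i hi i' hi' h => by
            have hi := (memR i).1 hi
            have hi' := (memR i').1 hi'
            exact hcol k (by omega) hk i hi.1 i' hi'.1 h)
          (fun i hi h => by
            have hi := (memR i).1 hi
            have := hcol k (by omega) hk i hi.1 (N - k) (by omega) h
            omega)
      simp only [memR] at e1 e3 e4 e5 e6 e8 e9 e10
      replace e2 : ∀ i < N, N < i + k → ∀ i' < N, N < i' + k → β i = β i' → i = i' :=
        fun i a b i' a' b' h => e2 ((memR i).2 ⟨a, b⟩) ((memR i').2 ⟨a', b'⟩) h
      replace e7 : ∀ i < N, N < i + k → ∀ i' < N, N < i' + k → u' i = u' i' → i = i' :=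
        fun i a b i' a' b' h => e7 ((memR i).2 ⟨a, b⟩) ((memR i').2 ⟨a', b'⟩) h
      obtain ⟨a, rfl⟩ : ∃ a, N = a + k := ⟨N - k, by omega⟩
      simp only [Nat.add_sub_cancel] at *
      have hβ : ∀ i < a + k, a + k < i + k → ∃ l, a ≤ l ∧ l < a + k ∧ β i = T l k := by
        intro i hi hi'
        rcases e4 i ⟨hi, hi'⟩ with h | ⟨l, hl, h⟩
        · exact ⟨a, le_rfl, by omega, h⟩
        · exact ⟨l, by omega, hl.1, h⟩
      have hw : ∃ l, a ≤ l ∧ l < a + k ∧ w = T l k := by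
        rcases e5 with h | ⟨l, hl, h⟩
        · exact ⟨a, le_rfl, by omega, h⟩
        · exact ⟨l, by omega, hl.1, h⟩
      have hlt : ∀ i < a + k, a + k < i + (k + 1) → i = a ∨ a + k < i + k := by omega
      obtain ⟨c, hc1, hc2, hc3, hc4⟩ : ∃ c : ℕ → ℕ, (∀ i < a, c i = T i k) ∧ c a = a + k ∧
          (∀ i, a < i → i < a + k → c i = β i) ∧ c (a + k) = w := by
        refine ⟨fun i => if i < a then T i k else if i = a then a + k
          else if i < a + k then β i else w, ?_, ?_, ?_, ?_⟩
        · intro i hi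
          simp [hi]
        · simp
        · intro i hi hi'
          simp [hi', hi.ne', hi.not_gt]
        · simp [show k ≠ 0 by omega]
      obtain ⟨v, hva, hv⟩ : ∃ v : ℕ → ℕ, v a = T a k ∧ ∀ i, i ≠ a → v i = u' i :=
        ⟨fun i => if i = a then T a k else u' i, by simp, fun i hi => by simp [hi]⟩
      have hk' : k < a + k := by omega
      have hcT : ∀ i ≤ a + k, i ≠ a → ∃ l < a + k, c i = T l k ∧ (i < a → l = i) ∧
          (a < i → a ≤ l) := by
        intro i hi hia
        rcases lt_or_gt_of_ne hia with h | h
        · exact ⟨i, by omega, hc1 i h, fun _ => rfl, by omega⟩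
        · rcases hi.lt_or_eq with h' | h'
          · obtain ⟨l, hl, hl', e⟩ := hβ i h' (by omega)
            exact ⟨l, hl', by rw [hc3 i h h', e], by omega, fun _ => hl⟩
          · obtain ⟨l, hl, hl', e⟩ := hw
            exact ⟨l, hl', by rw [h', hc4, e], by omega, fun _ => hl⟩
      have hcrow : ∀ i ≤ a + k, 1 ≤ i → ∀ j < k, L i j ≠ c i := by
        intro i hi hi1 j hj e
        rcases lt_trichotomy i a with h | h | h
        · rw [hc1 i h, h1 j hj i (by omega)] at e
          have := hrow i (by omega) hi1 j (by omega) k hk' e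
          omega
        · subst h
          rw [hc2, h1 j hj i (by omega)] at e
          have := hT i (by omega) j (by omega)
          omega
        · have hcN : c i < a + k := by
            obtain ⟨l, hl, e, -⟩ := hcT i hi h.ne'
            rw [e]
            exact hT l hl k hk'
          rcases hi.lt_or_eq with h' | h'
          · rcases h7 i h' (by omega) j hj with hN | ⟨⟨j', hj', e'⟩, hne⟩
            · omega
            · rw [hc3 i h h'] at e
              rcases e1 i ⟨h', by omega⟩ with ⟨hb, -⟩ | ⟨hb, -⟩
              · exact hne (e.trans hb)
              · have := hrow i h' hi1 j' (by omega) k hk' (by rw [← e', e, hb])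
                omega
          · subst h'
            rcases h9 j hj with hN | ⟨l, hl, hl', e'⟩
            · omega
            · exact e6 l ⟨hl, hl'⟩ (by rw [← e', e, hc4])
      have hcT' : ∀ l < a + k, ∀ l' < a + k, T l k = T l' k → l = l' := hcol k hk' hk
      have hccol : ∀ i ≤ a + k, ∀ i' ≤ a + k, i < i' → c i ≠ c i' := by
        intro i hi i' hi' hlt e
        by_cases hia : i = a
        · obtain ⟨l, hl, e', -⟩ := hcT i' hi' (by omega)
          have := hT l hl k hk'
          rw [hia, hc2] at e
          omega
        by_cases hia' : i' = a
        · obtain ⟨l, hl, e', -⟩ := hcT i hi (by omega)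
          have := hT l hl k hk'
          rw [hia', hc2] at e
          omega
        by_cases h : i < a
        · obtain ⟨l, hl, e', g1, g2⟩ := hcT i hi hia
          obtain ⟨l', hl', e'', g1', g2'⟩ := hcT i' hi' hia'
          have := hcT' l hl l' hl' (by rw [← e', e, e''])
          omega
        · have hai : a < i := by omega
          rw [hc3 i hai (by omega)] at e
          rcases hi'.lt_or_eq with h' | h'
          · rw [hc3 i' (by omega) h'] at e
            have := e2 i (by omega) (by omega) i' h' (by omega) e
            omega
          · rw [h', hc4] at e
            exact e3 i ⟨by omega, by omega⟩ e
      have hcle : ∀ i ≤ a + k, c i ≤ a + k := by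
        intro i hi
        by_cases hia : i = a
        · rw [hia, hc2]
        · obtain ⟨l, hl, e', -⟩ := hcT i hi hia
          rw [e']
          exact (hT l hl k hk').le
      obtain ⟨M, hM, hMk⟩ : ∃ M : ℕ → ℕ → ℕ, (∀ i, ∀ j < k, M i j = L i j) ∧
          ∀ i, M i k = c i :=
        ⟨fun i j => if j = k then c i else L i j, fun i j hj => by simp [hj.ne], by simp⟩
      have hsplit : ∀ j < k + 1, j < k ∨ j = k := by omega
      refine ⟨M, v, ?_, ?_, ?_, ?_, ?_, ?_, ?_, ?_, ?_⟩
      · intro j hj i hij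
        rcases hsplit j hj with hj | rfl
        · rw [hM i j hj, h1 j hj i hij]
        · rw [hMk, hc1 i (by omega)]
      · intro j hj i hij
        rcases hsplit j hj with hj | rfl
        · rw [hM i j hj, h2 j hj i hij]
        · rw [hMk, show i = a by omega, hc2]
      · intro i hi hi1 j hj j' hj' e
        rcases hsplit j hj with hj | rfl <;> rcases hsplit j' hj' with hj' | rfl
        · rw [hM i j hj, hM i j' hj'] at e
          exact h3 i hi hi1 j hj j' hj' e
        · rw [hM i j hj, hMk] at e
          exact (hcrow i hi hi1 j hj e).elim
        · rw [hM i j' hj', hMk] at e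
          exact (hcrow i hi hi1 j' hj' e.symm).elim
        · rfl
      · intro j hj hj1 i hi i' hi' e
        rcases hsplit j hj with hj | rfl
        · rw [hM i j hj, hM i' j hj] at e
          exact h4 j hj hj1 i hi i' hi' e
        · rw [hMk, hMk] at e
          rcases lt_trichotomy i i' with h | h | h
          · exact (hccol i hi i' hi' h e).elim
          · exact h
          · exact (hccol i' hi' i hi h e.symm).elim
      · intro i hi j hj
        rcases hsplit j hj with hj | rfl
        · rw [hM i j hj]
          exact h5 i hi j hj
        · rw [hMk]
          exact hcle i hi
      · intro i hi hik
        rcases hlt i hi hik with rfl | h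
        · exact ⟨k, by omega, hva⟩
        · rw [hv i (by omega)]
          rcases e1 i ⟨hi, h⟩ with ⟨-, e⟩ | ⟨-, e⟩
          · exact ⟨k, by omega, e⟩
          · obtain ⟨j, hj, e'⟩ := h6 i hi h
            exact ⟨j, by omega, e.trans e'⟩
      · intro i hi hik j hj
        rcases hlt i hi hik with rfl | h
        · rcases hsplit j hj with hj | rfl
          · rw [hM i j hj, h1 j hj i (by omega), hva]
            by_cases hi0 : i = 0
            · omega
            · refine .inr ⟨⟨j, by omega, rfl⟩, fun e => ?_⟩
              have := hrow i hi (by omega) j (by omega) k hk' e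
              omega
          · exact .inl (by rw [hMk, hc2])
        · rw [hv i (by omega)]
          have hTu : ∃ j' < k, u i = T i j' := h6 i hi h
          rcases hsplit j hj with hj | rfl
          · rw [hM i j hj]
            rcases h7 i hi h j hj with e | ⟨⟨j', hj', e⟩, hne⟩
            · exact .inl e
            · refine .inr ⟨⟨j', by omega, e⟩, ?_⟩
              rcases e1 i ⟨hi, h⟩ with ⟨-, e'⟩ | ⟨-, e'⟩
              · rw [e', e]
                intro e''
                have := hrow i hi (by omega) j' (by omega) k hk' e''
                omega
              · rwa [e']
          · rw [hMk, hc3 i (by omega) hi]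
            obtain ⟨j', hj', eu⟩ := hTu
            have hne : u i ≠ T i j := by
              rw [eu]
              intro e
              have := hrow i hi (by omega) j' (by omega) j hk' e
              omega
            rcases e1 i ⟨hi, h⟩ with ⟨hb, e'⟩ | ⟨hb, e'⟩
            · rw [hb, e']
              exact .inr ⟨⟨j', by omega, eu⟩, hne⟩
            · rw [hb, e']
              exact .inr ⟨⟨j, by omega, rfl⟩, hne.symm⟩
      · intro i hi hik i' hi' hik' e
        rcases hlt i hi hik with rfl | h <;> rcases hlt i' hi' hik' with rfl | h'
        · rfl
        · rw [hva, hv i' (by omega)] at e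
          exact (e8 i' ⟨hi', h'⟩ e.symm).elim
        · rw [hva, hv i (by omega)] at e
          exact (e8 i ⟨hi, h⟩ e).elim
        · rw [hv i (by omega), hv i' (by omega)] at e
          exact e7 i hi h i' hi' h' e
      · intro j hj
        have hlast : ∀ y, (y = T a k ∨ ∃ l, (l < a + k ∧ a + k < l + k) ∧ y = u' l) →
            ∃ i < a + k, a + k < i + (k + 1) ∧ y = v i := by
          rintro y (h | ⟨l, hl, h⟩)
          · exact ⟨a, by omega, by omega, h.trans hva.symm⟩
          · exact ⟨l, hl.1, by omega, h.trans (hv l (by omega)).symm⟩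
        rcases hsplit j hj with hj | rfl
        · rw [hM _ j hj]
          rcases h9 j hj with e | ⟨i, hi, hik, e⟩
          · exact .inl e
          · rw [e]
            exact .inr (hlast _ (e9 i ⟨hi, hik⟩))
        · rw [hMk, hc4]
          exact .inr (hlast _ e10)
  obtain ⟨L, u, h1, h2, h3, h4, h5, h6, h7, h8, h9⟩ := main N hN le_rfl
  have huN : ∀ i < N, 1 ≤ i → u i < N := by
    intro i hi hi1
    obtain ⟨j, hj, e⟩ := h6 i hi (by omega)
    rw [e]
    exact hT i hi j hj
  obtain ⟨w, hwN, hw⟩ : ∃ w < N, ∀ i < N, 1 ≤ i → u i ≠ w := by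
    obtain ⟨w, hw, hw'⟩ := Finset.exists_mem_notMem_of_card_lt_card
      (s := (Finset.Ioo 0 N).image u) (t := Finset.range N)
      (Finset.card_image_le.trans_lt (by rw [Nat.card_Ioo, Finset.card_range]; omega))
    refine ⟨w, Finset.mem_range.1 hw, fun i hi hi1 e => hw' ?_⟩
    exact Finset.mem_image.2 ⟨i, Finset.mem_Ioo.2 ⟨by omega, hi⟩, e⟩
  obtain ⟨c, hc1, hc2, hc3⟩ : ∃ c : ℕ → ℕ, c 0 = N ∧ (∀ i < N, 1 ≤ i → c i = u i) ∧ c N = w :=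
    ⟨fun i => if i = 0 then N else if i < N then u i else w, by simp,
      fun i hi hi1 => by simp [hi, show i ≠ 0 by omega], by simp [show N ≠ 0 by omega]⟩
  obtain ⟨M, hM, hMN⟩ : ∃ M : ℕ → ℕ → ℕ, (∀ i, ∀ j < N, M i j = L i j) ∧ ∀ i, M i N = c i :=
    ⟨fun i j => if j = N then c i else L i j, fun i j hj => by simp [hj.ne], by simp⟩
  have hcN : ∀ i ≤ N, 1 ≤ i → c i < N := by
    intro i hi hi1
    rcases hi.lt_or_eq with h | rfl
    · rw [hc2 i h hi1]
      exact huN i h hi1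
    · rwa [hc3]
  have hcrow : ∀ i ≤ N, 1 ≤ i → ∀ j < N, L i j ≠ c i := by
    intro i hi hi1 j hj e
    have := hcN i hi hi1
    rcases hi.lt_or_eq with h | rfl
    · rw [hc2 i h hi1] at e this
      rcases h7 i h (by omega) j hj with e' | ⟨-, e'⟩
      · omega
      · exact e' e
    · rcases h9 j hj with e' | ⟨l, hl, hl', e'⟩
      · omega
      · exact hw l hl (by omega) (by rw [← e', e, hc3])
  have hccol : ∀ i ≤ N, ∀ i' ≤ N, i < i' → c i ≠ c i' := by
    intro i hi i' hi' hlt e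
    by_cases hi0 : i = 0
    · have := hcN i' hi' (by omega)
      rw [hi0, hc1] at e
      omega
    · rw [hc2 i (by omega) (by omega)] at e
      rcases hi'.lt_or_eq with h | h
      · rw [hc2 i' h (by omega)] at e
        have := h8 i (by omega) (by omega) i' h (by omega) e
        omega
      · rw [h, hc3] at e
        exact hw i (by omega) (by omega) e
  refine ⟨M, ?_, ?_, ?_, ?_, ?_⟩
  · intro i j hij
    rw [hM i j (by omega), h1 j (by omega) i hij]
  · intro i j hij
    rcases (show j ≤ N by omega).lt_or_eq with h | rfl
    · rw [hM i j h, h2 j h i hij]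
    · rw [hMN, show i = 0 by omega, hc1]
  · intro i hi hi1 j hj j' hj' e
    rcases hj.lt_or_eq with hj | rfl <;> rcases hj'.lt_or_eq with hj' | rfl
    · rw [hM i j hj, hM i j' hj'] at e
      exact h3 i hi hi1 j hj j' hj' e
    · rw [hM i j hj, hMN] at e
      exact (hcrow i hi hi1 j hj e).elim
    · rw [hM i j' hj', hMN] at e
      exact (hcrow i hi hi1 j' hj' e.symm).elim
    · rfl
  · intro j hj hj1 i hi i' hi' e
    rcases hj.lt_or_eq with hj | rfl
    · rw [hM i j hj, hM i' j hj] at e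
      exact h4 j hj hj1 i hi i' hi' e
    · rw [hMN, hMN] at e
      rcases lt_trichotomy i i' with h | h | h
      · exact (hccol i hi i' hi' h e).elim
      · exact h
      · exact (hccol i' hi' i hi h e.symm).elim
  · intro i hi j hj
    rcases hj.lt_or_eq with hj | rfl
    · rw [hM i j hj]
      exact h5 i hi j hj
    · rw [hMN]
      rcases Nat.eq_zero_or_pos i with rfl | h
      · rw [hc1]
      · exact (hcN i hi h).le

/-- `π` and `ρ` reorder the rows `R` and the columns `C` of a `(k + 1) × (k + 1)` array such that
the cells in `F` come above the antidiagonal and the cell `(p, q)` comes to lie on it. -/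
structure IsArrangement {α β : Type} (F : α → β → Prop) (p : α) (q : β) (k : ℕ) (R : Finset α)
    (C : Finset β) (π : α → ℕ) (ρ : β → ℕ) : Prop where
  row_inj : Set.InjOn π R
  col_inj : Set.InjOn ρ C
  row_le : ∀ i ∈ R, π i ≤ k
  col_le : ∀ j ∈ C, ρ j ≤ k
  lt : ∀ i ∈ R, ∀ j ∈ C, F i j → π i + ρ j < k
  eq : π p + ρ q = k

theorem IsArrangement.swap {α β : Type} {F : α → β → Prop} {p : α} {q : β} {k : ℕ} {R : Finset α}
    {C : Finset β} {π : α → ℕ} {ρ : β → ℕ} (h : IsArrangement F p q k R C π ρ) :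
    IsArrangement (fun j i => F i j) q p k C R ρ π :=
  ⟨h.2, h.1, h.4, h.3, fun j hj i hi hF => by rw [add_comm]; exact h.lt i hi j hj hF,
    by rw [add_comm]; exact h.eq⟩

theorem IsArrangement.cons_col {α β : Type} [DecidableEq α] [DecidableEq β] {F : α → β → Prop}
    {p : α} {q : β} {k : ℕ} {R : Finset α} {C : Finset β} {π : α → ℕ} {ρ : β → ℕ} {a : α} {b : β}
    (h : IsArrangement F p q k (R.erase a) (C.erase b) π ρ) (hap : a ≠ p) (hbq : b ≠ q)
    (hF : ∀ j ∈ C, ¬ F a j) :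
    IsArrangement F p q (k + 1) R C (fun i => if i = a then k + 1 else π i)
      (fun j => if j = b then 0 else ρ j + 1) := by
  have hR : ∀ i ∈ R, i ≠ a → i ∈ R.erase a := fun i hi hia => mem_erase.2 ⟨hia, hi⟩
  have hC : ∀ j ∈ C, j ≠ b → j ∈ C.erase b := fun j hj hjb => mem_erase.2 ⟨hjb, hj⟩
  refine ⟨?_, ?_, ?_, ?_, ?_, ?_⟩
  · intro i hi i' hi' e
    simp only at e
    split_ifs at e with h1 h2 h2
    · rw [h1, h2]
    · have := h.row_le _ (hR i' hi' h2)
      omega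
    · have := h.row_le _ (hR i hi h1)
      omega
    · exact h.row_inj (hR i hi h1) (hR i' hi' h2) e
  · intro j hj j' hj' e
    simp only at e
    split_ifs at e with h1 h2 h2
    · rw [h1, h2]
    · exact h.col_inj (hC j hj h1) (hC j' hj' h2) (by omega)
  · intro i hi
    split_ifs with h1
    · exact le_rfl
    · exact (h.row_le _ (hR i hi h1)).trans (Nat.le_succ k)
  · intro j hj
    split_ifs with h1
    · omega
    · exact Nat.succ_le_succ (h.col_le _ (hC j hj h1))
  · intro i hi j hj hij
    have hia : i ≠ a := by
      rintro rfl
      exact hF j hj hij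
    simp only [if_neg hia]
    split_ifs with h1
    · have := h.row_le _ (hR i hi hia)
      omega
    · have := h.lt _ (hR i hi hia) _ (hC j hj h1) hij
      omega
  · simp only [if_neg hap.symm, if_neg hbq.symm]
    have := h.eq
    omega

theorem exists_injOn_le {α : Type} [DecidableEq α] {R : Finset α} {p : α} (hp : p ∈ R) {k : ℕ}
    (hR : #R = k + 1) : ∃ f : α → ℕ, Set.InjOn f R ∧ (∀ i ∈ R, f i ≤ k) ∧ f p = 0 := by
  have hcard : #(R.erase p) = k := by rw [card_erase_of_mem hp, hR, Nat.add_sub_cancel]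
  let e := (R.erase p).equivFinOfCardEq hcard
  refine ⟨fun i => if h : i ∈ R.erase p then (e ⟨i, h⟩).val + 1 else 0, ?_, ?_, ?_⟩
  · intro i hi i' hi' h
    have hi'' : i ∉ R.erase p → i = p := fun h => by
      by_contra h'
      exact h (mem_erase.2 ⟨h', hi⟩)
    have hi''' : i' ∉ R.erase p → i' = p := fun h => by
      by_contra h'
      exact h (mem_erase.2 ⟨h', hi'⟩)
    simp only at h
    split_ifs at h with h1 h2 h2
    · have := e.injective (Fin.ext (Nat.succ_injective h))
      exact congrArg Subtype.val this
    · rw [hi'' h1, hi''' h2]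
  · intro i hi
    simp only
    split_ifs with h
    · exact (e ⟨i, h⟩).isLt
    · omega
  · simp

theorem exists_mem_forall_not {α β : Type} [DecidableEq α] (F : α → β → Prop)
    (R' : Finset α) (C : Finset β) (S : Finset (α × β))
    (hS : ∀ i ∈ R', ∀ j ∈ C, F i j → (i, j) ∈ S) (hcard : #S < #R') :
    ∃ a ∈ R', ∀ j ∈ C, ¬ F a j := by
  obtain ⟨a, ha, ha'⟩ := exists_mem_notMem_of_card_lt_card (s := S.image Prod.fst) (t := R')
    (card_image_le.trans_lt hcard)
  exact ⟨a, ha, fun j hj hF => ha' (mem_image_of_mem Prod.fst (hS a ha j hj hF))⟩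

theorem exists_isArrangement {α β : Type} [DecidableEq α] [DecidableEq β] (F : α → β → Prop)
    (p : α) (q : β) (hpq : ¬ F p q) (k : ℕ) (R : Finset α) (C : Finset β) (hp : p ∈ R) (hq : q ∈ C)
    (hR : #R = k + 1) (hC : #C = k + 1) (S : Finset (α × β))
    (hS : ∀ i ∈ R, ∀ j ∈ C, F i j → (i, j) ∈ S) (hcard : #S + 1 ≤ k) :
    ∃ π ρ, IsArrangement F p q k R C π ρ := by
  induction k generalizing R C S with
  | zero => omega
  | succ k ih =>
  have hRe : ∀ a ∈ R, #(R.erase a) = k + 1 := fun a ha => by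
    rw [card_erase_of_mem ha, hR, Nat.add_sub_cancel]
  have hCe : ∀ a ∈ C, #(C.erase a) = k + 1 := fun a ha => by
    rw [card_erase_of_mem ha, hC, Nat.add_sub_cancel]
  by_cases hne : ∃ i ∈ R, ∃ j ∈ C, F i j
  · obtain ⟨i, hi, j, hj, hij⟩ := hne
    have hS' : #(S.erase (i, j)) + 1 = #S := card_erase_add_one (hS i hi j hj hij)
    by_cases hjq : j = q
    · have hip : i ≠ p := by
        rintro rfl
        exact hpq (hjq ▸ hij)
      obtain ⟨b, hb, hb'⟩ := exists_mem_forall_not (fun j i => F i j) (C.erase q) R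
        (S.image Prod.swap)
        (fun j hj i hi h => mem_image.2 ⟨(i, j), hS i hi j (mem_of_mem_erase hj) h, rfl⟩)
        (card_image_le.trans_lt (by rw [hCe q hq]; omega))
      obtain ⟨hbq, hbC⟩ := mem_erase.1 hb
      obtain ⟨π, ρ, h⟩ := ih (R.erase i) (C.erase b) (mem_erase.2 ⟨hip.symm, hp⟩)
        (mem_erase.2 ⟨hbq.symm, hq⟩) (hRe i hi) (hCe b hbC) (S.erase (i, j))
        (fun i' hi' j' hj' h => mem_erase.2 ⟨fun e => (mem_erase.1 hi').1 (congrArg Prod.fst e),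
          hS i' (mem_of_mem_erase hi') j' (mem_of_mem_erase hj') h⟩) (by omega)
      exact ⟨_, _, (h.swap.cons_col hbq hip hb').swap⟩
    · obtain ⟨a, ha, ha'⟩ := exists_mem_forall_not F (R.erase p) C S
        (fun i hi j hj h => hS i (mem_of_mem_erase hi) j hj h) (by rw [hRe p hp]; omega)
      obtain ⟨hap, haR⟩ := mem_erase.1 ha
      obtain ⟨π, ρ, h⟩ := ih (R.erase a) (C.erase j) (mem_erase.2 ⟨hap.symm, hp⟩)
        (mem_erase.2 ⟨Ne.symm hjq, hq⟩) (hRe a haR) (hCe j hj) (S.erase (i, j))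
        (fun i' hi' j' hj' h => mem_erase.2 ⟨fun e => (mem_erase.1 hj').1 (congrArg Prod.snd e),
          hS i' (mem_of_mem_erase hi') j' (mem_of_mem_erase hj') h⟩) (by omega)
      exact ⟨_, _, h.cons_col hap hjq ha'⟩
  · push Not at hne
    obtain ⟨f, hf, hfk, hfp⟩ := exists_injOn_le hp hR
    obtain ⟨g, hg, hgk, hgq⟩ := exists_injOn_le hq hC
    refine ⟨f, fun j => k + 1 - g j, hf, ?_, hfk, fun j _ => Nat.sub_le _ _,
      fun i hi j hj h => (hne i hi j hj h).elim, by simp [hfp, hgq]⟩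
    intro j hj j' hj' h
    have := hgk j hj
    have := hgk j' hj'
    exact hg hj hj' (by simp only at h; omega)

theorem exists_isArrangement_zero {N : ℕ} (F : Fin (N + 1) → Fin (N + 1) → Prop)
    (p q : Fin (N + 1)) (hp : p ≠ 0) (hq : q ≠ 0) (hpq : ¬ F p q)
    (S : Finset (Fin (N + 1) × Fin (N + 1))) (hS : ∀ x, x ∈ S ↔ F x.1 x.2)
    (hcard : #S + 1 ≤ N) (hp0 : F p 0)
    (h0 : ∃ i j, F i j ∧ (i, j) ≠ (p, 0) ∧ (i = 0 ∨ j = 0)) :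
    ∃ π ρ, IsArrangement F p q N univ univ π ρ ∧ π 0 = 0 ∧ ρ 0 = 0 := by
  obtain ⟨i, j, hij, hne, hij0⟩ := h0
  have hm1 : (p, 0) ∈ S := (hS _).2 hp0
  have hm2 : (i, j) ∈ S.erase (p, 0) := mem_erase.2 ⟨hne, (hS _).2 hij⟩
  have hc1 := card_erase_add_one hm1
  have hc2 := card_erase_add_one hm2
  obtain ⟨k, rfl⟩ : ∃ k, N = k + 2 := ⟨N - 2, by omega⟩
  have hu : #(univ : Finset (Fin (k + 2 + 1))) = k + 3 := by simp
  have hup : #(univ.erase p) = k + 2 := by rw [card_erase_of_mem (mem_univ _), hu]; omega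
  have huq : #(univ.erase q) = k + 2 := by rw [card_erase_of_mem (mem_univ _), hu]; omega
  have hup0 : #((univ.erase p).erase 0) = k + 1 := by
    rw [card_erase_of_mem (by simp [hp.symm]), hup]; omega
  have huq0 : #((univ.erase q).erase 0) = k + 1 := by
    rw [card_erase_of_mem (by simp [hq.symm]), huq]; omega
  obtain ⟨a, ha, ha'⟩ := exists_mem_forall_not F ((univ.erase p).erase 0) univ (S.erase (p, 0))
    (by
      intro i' hi' j' _ h
      refine mem_erase.2 ⟨?_, (hS _).2 h⟩
      rintro e
      simp only [mem_erase] at hi'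
      exact hi'.2.1 (congrArg Prod.fst e)) (by omega)
  obtain ⟨b, hb, hb'⟩ := exists_mem_forall_not (fun j i => F i j) ((univ.erase q).erase 0) univ
    ((S.erase (p, 0)).image Prod.swap)
    (by
      intro j' hj' i' _ h
      refine mem_image.2 ⟨(i', j'), mem_erase.2 ⟨?_, (hS _).2 h⟩, rfl⟩
      rintro e
      simp only [mem_erase] at hj'
      exact hj'.1 (congrArg Prod.snd e)) (card_image_le.trans_lt (by omega))
  simp only [mem_erase, mem_univ, and_true] at ha hb
  obtain ⟨π, ρ, h⟩ := exists_isArrangement F p q hpq k ((univ.erase a).erase 0)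
    ((univ.erase 0).erase b) (by simp [hp, Ne.symm ha.2]) (by simp [hq, Ne.symm hb.2])
    (by rw [card_erase_of_mem (by simp [Ne.symm ha.1]), card_erase_of_mem (mem_univ _), hu]; omega)
    (by rw [card_erase_of_mem (by simp [hb.1]), card_erase_of_mem (mem_univ _), hu]; omega)
    ((S.erase (p, 0)).erase (i, j))
    (by
      intro i' hi' j' hj' h
      simp only [mem_erase, mem_univ, and_true] at hi' hj'
      refine mem_erase.2 ⟨?_, mem_erase.2 ⟨?_, (hS _).2 h⟩⟩
      · intro e
        rcases hij0 with rfl | rfl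
        · exact hi'.1 (congrArg Prod.fst e)
        · exact hj'.2 (congrArg Prod.snd e)
      · exact fun e => hj'.2 (congrArg Prod.snd e)) (by omega)
  refine ⟨_, _, ((h.swap.cons_col hb.2 hp.symm fun i _ => hb' i (mem_univ _)).swap).cons_col
    ha.2 hq.symm ha', ?_, ?_⟩
  · simp [Ne.symm ha.1]
  · simp

theorem isCompletable_of_isArrangement {N : ℕ} (hN : 1 ≤ N) (sp : Prop)
    (P : Finset (Fin (N + 1) × Fin (N + 1) × Fin (N + 1))) (hP : IsPartialSquare sp P)
    (t₀ : Fin (N + 1) × Fin (N + 1) × Fin (N + 1)) (ht₀ : t₀ ∈ P)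
    (huniq : ∀ t ∈ P, t.2.2 = t₀.2.2 → t = t₀) (π ρ : Fin (N + 1) → ℕ)
    (h : IsArrangement (fun i j => ∃ k, (i, j, k) ∈ P.erase t₀) t₀.1 t₀.2.1 N univ univ π ρ)
    (h0 : sp → π 0 = 0 ∧ ρ 0 = 0)
    (ih : ∀ P' : Finset (Fin N × Fin N × Fin N), IsPartialSquare sp P' → #P' < #P →
      IsCompletable sp P') : IsCompletable sp P := by
  classical
  have hπ : ∀ i i', π i = π i' → i = i' := fun i i' e =>
    h.row_inj (by simp) (by simp) e
  have hρ : ∀ j j', ρ j = ρ j' → j = j' := fun j j' e =>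
    h.col_inj (by simp) (by simp) e
  have hπN : ∀ i, π i ≤ N := fun i => h.row_le i (mem_univ _)
  have hρN : ∀ j, ρ j ≤ N := fun j => h.col_le j (mem_univ _)
  have hπ0 : sp → ∀ i, π i = 0 ↔ i.val = 0 := fun hsp i =>
    ⟨fun e => congrArg Fin.val (hπ i 0 (e.trans (h0 hsp).1.symm)), fun e => by
      rw [show i = 0 from Fin.ext e]; exact (h0 hsp).1⟩
  have hρ0 : sp → ∀ i, ρ i = 0 ↔ i.val = 0 := fun hsp i =>
    ⟨fun e => congrArg Fin.val (hρ i 0 (e.trans (h0 hsp).2.symm)), fun e => by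
      rw [show i = 0 from Fin.ext e]; exact (h0 hsp).2⟩
  let ξ := Equiv.swap t₀.2.2 (Fin.last N)
  have hξ : ∀ k, k ≠ t₀.2.2 → (ξ k).val < N := by
    intro k hk
    refine Fin.val_lt_last fun e => hk ?_
    have : ξ (ξ k) = ξ (Fin.last N) := congrArg ξ e
    rwa [Equiv.swap_apply_right, Equiv.swap_apply_self] at this
  have hlt : ∀ t ∈ P.erase t₀, π t.1 + ρ t.2.1 < N := fun t ht =>
    h.lt _ (mem_univ _) _ (mem_univ _) ⟨_, ht⟩
  have hξP : ∀ t ∈ P.erase t₀, (ξ t.2.2).val < N := fun t ht =>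
    hξ _ fun e => (mem_erase.1 ht).1 (huniq t (mem_of_mem_erase ht) e)
  let P' : Finset (Fin N × Fin N × Fin N) := {s | ∃ t ∈ P.erase t₀,
    π t.1 = s.1 ∧ ρ t.2.1 = s.2.1 ∧ (ξ t.2.2).val = s.2.2}
  have hP' : ∀ s ∈ P', ∃ t ∈ P.erase t₀, π t.1 = s.1 ∧ ρ t.2.1 = s.2.1 ∧
      (ξ t.2.2).val = s.2.2 := fun s hs => (mem_filter.1 hs).2
  have hext : ∀ s s' : Fin N × Fin N × Fin N, s.1.val = s'.1.val → s.2.1.val = s'.2.1.val →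
      s.2.2.val = s'.2.2.val → s = s' := fun s s' e1 e2 e3 =>
    Prod.ext (Fin.ext e1) (Prod.ext (Fin.ext e2) (Fin.ext e3))
  have hξinj : ∀ k k', (ξ k).val = (ξ k').val → k = k' := fun k k' e => ξ.injective (Fin.ext e)
  have hcard : #P' ≤ #(P.erase t₀) := by
    choose! g hg1 hg2 hg3 hg4 using hP'
    refine card_le_card_of_injOn g hg1 fun s hs s' hs' e => ?_
    exact hext s s' (by rw [← hg2 s hs, ← hg2 s' hs', e]) (by rw [← hg3 s hs, ← hg3 s' hs', e])
      (by rw [← hg4 s hs, ← hg4 s' hs', e])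
  have hsq : IsPartialSquare sp P' := by
    refine ⟨?_, ?_, ?_, ?_⟩
    · intro s hs s' hs' e1 e2
      obtain ⟨t, ht, ht1, ht2, ht3⟩ := hP' s hs
      obtain ⟨t', ht', ht1', ht2', ht3'⟩ := hP' s' hs'
      have := hP.cell t (mem_of_mem_erase ht) t' (mem_of_mem_erase ht')
        (hπ _ _ (by rw [ht1, ht1', e1])) (hρ _ _ (by rw [ht2, ht2', e2]))
      subst this
      exact hext _ _ (ht1.symm.trans ht1') (ht2.symm.trans ht2') (ht3.symm.trans ht3')
    · intro s hs s' hs' e1 e2 hsp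
      obtain ⟨t, ht, ht1, ht2, ht3⟩ := hP' s hs
      obtain ⟨t', ht', ht1', ht2', ht3'⟩ := hP' s' hs'
      have := hP.row t (mem_of_mem_erase ht) t' (mem_of_mem_erase ht')
        (hπ _ _ (by rw [ht1, ht1', e1])) (hξinj _ _ (by rw [ht3, ht3', e2]))
        (fun h e => hsp h (by rw [← ht1, hπ0 h, e]))
      subst this
      exact hext _ _ (ht1.symm.trans ht1') (ht2.symm.trans ht2') (ht3.symm.trans ht3')
    · intro s hs s' hs' e1 e2 hsp
      obtain ⟨t, ht, ht1, ht2, ht3⟩ := hP' s hs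
      obtain ⟨t', ht', ht1', ht2', ht3'⟩ := hP' s' hs'
      have := hP.col t (mem_of_mem_erase ht) t' (mem_of_mem_erase ht')
        (hρ _ _ (by rw [ht2, ht2', e1])) (hξinj _ _ (by rw [ht3, ht3', e2]))
        (fun h e => hsp h (by rw [← ht2, hρ0 h, e]))
      subst this
      exact hext _ _ (ht1.symm.trans ht1') (ht2.symm.trans ht2') (ht3.symm.trans ht3')
    · intro s hs hsp
      obtain ⟨t, ht, ht1, ht2, -⟩ := hP' s hs
      rw [← ht1, ← ht2, Ne, Ne, hπ0 hsp, hρ0 hsp]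
      exact hP.corner t (mem_of_mem_erase ht) hsp
  obtain ⟨A, hA1, hA2, hA3⟩ := ih P' hsq (hcard.trans_lt (card_erase_lt_of_mem ht₀))
  obtain ⟨T, hT⟩ : ∃ T : ℕ → ℕ → ℕ, ∀ (i j : ℕ) (hi : i < N) (hj : j < N),
      T i j = A ⟨i, hi⟩ ⟨j, hj⟩ :=
    ⟨fun i j => if h : i < N ∧ j < N then A ⟨i, h.1⟩ ⟨j, h.2⟩ else 0,
      fun i j hi hj => by simp only [hi, hj, and_self, dif_pos]⟩
  have hTrow : ∀ i < N, (sp → i ≠ 0) → ∀ j < N, ∀ j' < N, T i j = T i j' → j = j' := by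
    intro i hi hi1 j hj j' hj' e
    rw [hT i j hi hj, hT i j' hi hj'] at e
    exact congrArg Fin.val (hA1 ⟨i, hi⟩ hi1 (Fin.ext e))
  have hTcol : ∀ j < N, (sp → j ≠ 0) → ∀ i < N, ∀ i' < N, T i j = T i' j → i = i' := by
    intro j hj hj1 i hi i' hi' e
    rw [hT i j hi hj, hT i' j hi' hj] at e
    exact congrArg Fin.val (@hA2 ⟨j, hj⟩ hj1 ⟨i, hi⟩ ⟨i', hi'⟩ (Fin.ext e))
  have hTN : ∀ i < N, ∀ j < N, T i j < N := fun i hi j hj => by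
    rw [hT i j hi hj]
    exact Fin.isLt _
  obtain ⟨L, hL1, hL2, hL3, hL4, hL5⟩ := smetaniuk hN T hTN
    (fun i hi hi1 => hTrow i hi fun _ => by omega) (fun j hj hj1 => hTcol j hj fun _ => by omega)
  have hLrow : ∀ i ≤ N, (sp → i ≠ 0) → ∀ j ≤ N, ∀ j' ≤ N, L i j = L i j' → j = j' := by
    intro i hi hi1 j hj j' hj' e
    rcases Nat.eq_zero_or_pos i with rfl | hpos
    · rcases hj.lt_or_eq with hj | hj <;> rcases hj'.lt_or_eq with hj' | hj'
      · rw [hL1 0 j (by omega), hL1 0 j' (by omega)] at e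
        exact hTrow 0 (by omega) hi1 j hj j' hj' e
      · rw [hL1 0 j (by omega), hL2 0 j' (by omega)] at e
        have := hTN 0 hN j hj
        omega
      · rw [hL2 0 j (by omega), hL1 0 j' (by omega)] at e
        have := hTN 0 hN j' hj'
        omega
      · omega
    · exact hL3 i hi hpos j hj j' hj' e
  have hLcol : ∀ j ≤ N, (sp → j ≠ 0) → ∀ i ≤ N, ∀ i' ≤ N, L i j = L i' j → i = i' := by
    intro j hj hj1 i hi i' hi' e
    rcases Nat.eq_zero_or_pos j with rfl | hpos
    · rcases hi.lt_or_eq with hi | hi <;> rcases hi'.lt_or_eq with hi' | hi'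
      · rw [hL1 i 0 (by omega), hL1 i' 0 (by omega)] at e
        exact hTcol 0 (by omega) hj1 i hi i' hi' e
      · rw [hL1 i 0 (by omega), hL2 i' 0 (by omega)] at e
        have := hTN i hi 0 hN
        omega
      · rw [hL2 i 0 (by omega), hL1 i' 0 (by omega)] at e
        have := hTN i' hi' 0 hN
        omega
      · omega
    · exact hL4 j hj hpos i hi i' hi' e
  refine ⟨fun i j => ξ ⟨L (π i) (ρ j), Nat.lt_succ_of_le (hL5 _ (hπN i) _ (hρN j))⟩, ?_, ?_, ?_⟩
  · intro i hi j j' e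
    exact hρ _ _ (hLrow _ (hπN i) (fun hsp => by rw [Ne, hπ0 hsp]; exact hi hsp) _ (hρN j) _
      (hρN j') (congrArg Fin.val (ξ.injective e)))
  · intro j hj i i' e
    exact hπ _ _ (hLcol _ (hρN j) (fun hsp => by rw [Ne, hρ0 hsp]; exact hj hsp) _ (hπN i) _
      (hπN i') (congrArg Fin.val (ξ.injective e)))
  · intro t ht
    by_cases htt : t = t₀
    · subst htt
      refine (congrArg ξ (Fin.ext ?_)).trans (Equiv.swap_apply_right _ _)
      exact hL2 _ _ h.eq
    · have ht' := mem_erase.2 ⟨htt, ht⟩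
      have hs := hlt t ht'
      have hi : π t.1 < N := by omega
      have hj : ρ t.2.1 < N := by omega
      have hmem : ((⟨π t.1, hi⟩, ⟨ρ t.2.1, hj⟩, ⟨(ξ t.2.2).val, hξP t ht'⟩) :
          Fin N × Fin N × Fin N) ∈ P' := mem_filter.2 ⟨mem_univ _, t, ht', rfl, rfl, rfl⟩
      have hval := congrArg Fin.val (hA3 _ hmem)
      refine (congrArg ξ (Fin.ext (b := ξ t.2.2) ?_)).trans (Equiv.swap_apply_self _ _ _)
      change L (π t.1) (ρ t.2.1) = _
      rw [hL1 _ _ hs, hT _ _ hi hj]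
      exact hval

theorem isCompletable_of_card_lt (n : ℕ) (P : Finset (Fin n × Fin n × Fin n))
    (hP : IsPartialSquare False P) (hcard : #P < n) : IsCompletable False P := by
  classical
  induction n with
  | zero => omega
  | succ N ih =>
  by_cases hsing : ∀ k, #{t ∈ P | t.2.2 = k} ≠ 1
  · exact isCompletable_of_no_singleton P hP hcard.le hsing
  push Not at hsing
  obtain ⟨z, hz⟩ := hsing
  obtain ⟨t₀, ht₀⟩ := card_eq_one.1 hz
  have hmem : t₀ ∈ P ∧ t₀.2.2 = z := mem_filter.1 (ht₀ ▸ mem_singleton_self t₀)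
  have huniq : ∀ t ∈ P, t.2.2 = t₀.2.2 → t = t₀ := fun t ht e =>
    mem_singleton.1 (ht₀ ▸ mem_filter.2 ⟨ht, e.trans hmem.2⟩)
  have hpos := card_pos.2 ⟨t₀, hmem.1⟩
  obtain ⟨π, ρ, h⟩ := exists_isArrangement (fun i j => ∃ k, (i, j, k) ∈ P.erase t₀) t₀.1 t₀.2.1
    (by
      rintro ⟨k, hk⟩
      exact (mem_erase.1 hk).1 (hP.cell _ (mem_of_mem_erase hk) t₀ hmem.1 rfl rfl)) N univ univ
    (mem_univ _) (mem_univ _) (by simp) (by simp) ((P.erase t₀).image fun t => (t.1, t.2.1))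
    (by
      rintro i - j - ⟨k, hk⟩
      exact mem_image.2 ⟨_, hk, rfl⟩)
    (by
      have := card_image_le (s := P.erase t₀) (f := fun t => (t.1, t.2.1))
      rw [card_erase_of_mem hmem.1] at this
      omega)
  exact isCompletable_of_isArrangement (by omega) False P hP t₀ hmem.1 huniq π ρ h False.elim
    fun P' hP' hlt => ih P' hP' (by omega)

/-- `A` is a proper edge colouring of `K_{n,n}` where the colours `r i` and `c j` are missing at the
row vertex `i` and the column vertex `j`, and it agrees with `P`, where row `0` and column `0` of
`P` prescribe missing colours. -/
structure IsSolution {n : ℕ} (P : Finset (Fin (n + 1) × Fin (n + 1) × Fin (n + 1)))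
    (A : Fin n → Fin n → Fin (n + 1)) (r c : Fin n → Fin (n + 1)) : Prop where
  row_inj : ∀ i j j', A i j = A i j' → j = j'
  col_inj : ∀ j i i', A i j = A i' j → i = i'
  ne_row : ∀ i j, A i j ≠ r i
  ne_col : ∀ i j, A i j ≠ c j
  inner : ∀ i j x, (i.succ, j.succ, x) ∈ P → A i j = x
  left : ∀ i x, (i.succ, 0, x) ∈ P → r i = x
  top : ∀ j x, (0, j.succ, x) ∈ P → c j = x

theorem IsSolution.mono {n : ℕ} {P P' : Finset (Fin (n + 1) × Fin (n + 1) × Fin (n + 1))}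
    {A : Fin n → Fin n → Fin (n + 1)} {r c : Fin n → Fin (n + 1)} (h : IsSolution P A r c)
    (hP : P' ⊆ P) : IsSolution P' A r c :=
  ⟨h.1, h.2, h.3, h.4, fun i j x hx => h.inner i j x (hP hx), fun i x hx => h.left i x (hP hx),
    fun j x hx => h.top j x (hP hx)⟩

theorem IsSolution.isCompletable {n : ℕ} {P : Finset (Fin (n + 1) × Fin (n + 1) × Fin (n + 1))}
    (hP : IsPartialSquare True P) {A : Fin n → Fin n → Fin (n + 1)} {r c : Fin n → Fin (n + 1)}
    (h : IsSolution P A r c) : IsCompletable True P := by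
  refine ⟨fun i j => Fin.cases (Fin.cases 0 c j) (fun i => Fin.cases (r i) (A i) j) i, ?_, ?_, ?_⟩
  · intro i hi
    obtain ⟨i, rfl⟩ := Fin.exists_succ_eq.2 fun e => hi trivial (congrArg Fin.val e)
    intro j j' e
    induction j using Fin.cases <;> induction j' using Fin.cases
    · rfl
    · exact (h.ne_row _ _ e.symm).elim
    · exact (h.ne_row _ _ e).elim
    · exact congrArg Fin.succ (h.row_inj _ _ _ e)
  · intro j hj
    obtain ⟨j, rfl⟩ := Fin.exists_succ_eq.2 fun e => hj trivial (congrArg Fin.val e)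
    intro i i' e
    induction i using Fin.cases <;> induction i' using Fin.cases
    · rfl
    · exact (h.ne_col _ _ e.symm).elim
    · exact (h.ne_col _ _ e).elim
    · exact congrArg Fin.succ (h.col_inj _ _ _ e)
  · rintro ⟨i, j, x⟩ ht
    induction i using Fin.cases <;> induction j using Fin.cases
    · rcases hP.corner _ ht trivial with h | h <;> exact (h rfl).elim
    · exact h.top _ _ ht
    · exact h.left _ _ ht
    · exact h.inner _ _ _ ht

theorem IsCompletable.exists_isSolution {n : ℕ}
    {P : Finset (Fin (n + 1) × Fin (n + 1) × Fin (n + 1))} (h : IsCompletable True P) :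
    ∃ A r c, IsSolution P A r c := by
  obtain ⟨L, h1, h2, h3⟩ := h
  refine ⟨fun i j => L i.succ j.succ, fun i => L i.succ 0, fun j => L 0 j.succ, ?_, ?_, ?_, ?_,
    fun i j x hx => h3 _ hx, fun i x hx => h3 _ hx, fun j x hx => h3 _ hx⟩
  · exact fun i j j' e => Fin.succ_injective _ (h1 i.succ (by simp) e)
  · exact fun j i i' e => Fin.succ_injective _ (h2 j.succ (by simp) e)
  · exact fun i j e => Fin.succ_ne_zero _ (h1 i.succ (by simp) e)
  · exact fun i j e => Fin.succ_ne_zero _ (h2 j.succ (by simp) e)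

theorem exists_partner {n : ℕ} (hn : 1 ≤ n) {τ : Type} (U : Finset τ) (hU : #U ≤ n)
    (r c : τ → Fin (n + 1)) :
    ∃ f : Fin (n + 1) → Fin n,
      (∀ s ∈ U, ∀ t ∈ U, c s = 0 → c t = 0 → f (r s) = f (r t) → r s = r t) ∧
      ∀ s ∈ U, c s = 0 → ∀ t ∈ U, c t ≠ (f (r s)).succ := by
  classical
  let X := {t ∈ U | c t = 0}.image r
  let Y : Finset (Fin n) := {j | ∀ t ∈ U, c t ≠ j.succ}
  have hX : #X ≤ #{t ∈ U | c t = 0} := card_image_le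
  have hY : #Yᶜ ≤ #{t ∈ U | ¬ c t = 0} := by
    have hex : ∀ j ∈ Yᶜ, ∃ t ∈ U, c t = j.succ := fun j hj => by simpa [Y] using hj
    rw [← card_image_of_injective Yᶜ (Fin.succ_injective n)]
    refine (card_le_card fun x hx => ?_).trans (card_image_le (f := c))
    obtain ⟨j, hj, rfl⟩ := mem_image.1 hx
    obtain ⟨t, ht, ht'⟩ := hex j hj
    exact mem_image.2 ⟨t, mem_filter.2 ⟨ht, by rw [ht']; exact Fin.succ_ne_zero j⟩, ht'⟩
  have hsum := card_filter_add_card_filter_not (s := U) (fun t => c t = 0)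
  rw [card_compl, Fintype.card_fin] at hY
  obtain ⟨f, hf, hf'⟩ := exists_subset_card_eq (s := Y) (n := #X) (by omega)
  let e := equivOfCardEq hf'.symm
  have : NeZero n := ⟨by omega⟩
  refine ⟨fun i => if h : i ∈ X then (e ⟨i, h⟩ : Fin n) else 0, ?_, ?_⟩
  · intro s hs t ht hs0 ht0 h
    have h1 : r s ∈ X := mem_image_of_mem r (mem_filter.2 ⟨hs, hs0⟩)
    have h2 : r t ∈ X := mem_image_of_mem r (mem_filter.2 ⟨ht, ht0⟩)
    simp only [h1, h2, dif_pos] at h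
    exact congrArg Subtype.val (e.injective (Subtype.ext h))
  · intro s hs hs0
    have h1 : r s ∈ X := mem_image_of_mem r (mem_filter.2 ⟨hs, hs0⟩)
    simp only [h1, dif_pos]
    exact (mem_filter.1 (hf (e ⟨r s, h1⟩).2)).2

theorem exists_isSolution {n : ℕ} (hn : 1 ≤ n) {ι : Type} [Nonempty ι]
    (P : ι → Finset (Fin (n + 1) × Fin (n + 1) × Fin (n + 1)))
    (hP : ∀ k, IsPartialSquare True (P k))
    (U : Finset (Fin (n + 1) × Fin (n + 1) × Fin (n + 1))) (hPU : ∀ k, P k ⊆ U) (hU : #U ≤ n)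
    (hpend : ∀ k k', ∀ t ∈ P k, t.1 = 0 ∨ t.2.1 = 0 → t ∈ P k') (b : Fin (n + 1))
    (hb : ∀ k, ∀ t ∈ P k, t.1 ≠ 0 → t.2.1 ≠ 0 → t.2.2 = b → (∀ k', k' = k) ∧
      ∀ s ∈ P k, (s.1 = t.1 → s.2.1 ≠ 0) ∧ (s.2.1 = t.2.1 → s.1 ≠ 0))
    (hcomp : ∀ k, ∀ Q : Finset (Fin n × Fin n × Fin n), IsPartialSquare False Q →
      (∀ y, #{t ∈ Q | t.2.2 = y} = #{t ∈ P k | t.2.2 = b.succAbove y}) → IsCompletable False Q) :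
    ∃ (A : ι → Fin n → Fin n → Fin (n + 1)) (r c : Fin n → Fin (n + 1)),
      ∀ k, IsSolution (P k) (A k) r c := by
  classical
  obtain ⟨f, hf, hfU⟩ := exists_partner hn U hU (fun t => t.1) (fun t => t.2.1)
  obtain ⟨g, hg, hgU⟩ := exists_partner hn U hU (fun t => t.2.1) (fun t => t.1)
  let cr : Fin (n + 1) × Fin (n + 1) × Fin (n + 1) → Fin n := fun t =>
    Fin.cases (motive := fun _ => Fin n) (g t.2.1) id t.1
  let cc : Fin (n + 1) × Fin (n + 1) × Fin (n + 1) → Fin n := fun t =>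
    Fin.cases (motive := fun _ => Fin n) (f t.1) id t.2.1
  have hcr0 : ∀ t, t.1 = 0 → cr t = g t.2.1 := fun t h => by simp only [cr, h, Fin.cases_zero]
  have hcr : ∀ t, t.1 ≠ 0 → t.1 = (cr t).succ := fun t h => by
    obtain ⟨i, hi⟩ := Fin.exists_succ_eq.2 h
    simp only [cr, ← hi, Fin.cases_succ, id]
  have hcc0 : ∀ t, t.2.1 = 0 → cc t = f t.1 := fun t h => by simp only [cc, h, Fin.cases_zero]
  have hcc : ∀ t, t.2.1 ≠ 0 → t.2.1 = (cc t).succ := fun t h => by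
    obtain ⟨i, hi⟩ := Fin.exists_succ_eq.2 h
    simp only [cc, ← hi, Fin.cases_succ, id]
  have hrow : ∀ k, ∀ s ∈ P k, ∀ t ∈ P k, cr s = cr t → s = t ∨ s.1 = t.1 ∧ s.1 ≠ 0 := by
    intro k s hs t ht e
    by_cases h1 : s.1 = 0 <;> by_cases h2 : t.1 = 0
    · rw [hcr0 s h1, hcr0 t h2] at e
      exact .inl ((hP k).cell s hs t ht (h1.trans h2.symm) (hg s (hPU k hs) t (hPU k ht) h1 h2 e))
    · rw [hcr0 s h1] at e
      exact (hgU s (hPU k hs) h1 t (hPU k ht) (by rw [e, hcr t h2])).elim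
    · rw [hcr0 t h2] at e
      exact (hgU t (hPU k ht) h2 s (hPU k hs) (by rw [← e, hcr s h1])).elim
    · exact .inr ⟨by rw [hcr s h1, hcr t h2, e], h1⟩
  have hcol : ∀ k, ∀ s ∈ P k, ∀ t ∈ P k, cc s = cc t → s = t ∨ s.2.1 = t.2.1 ∧ s.2.1 ≠ 0 := by
    intro k s hs t ht e
    by_cases h1 : s.2.1 = 0 <;> by_cases h2 : t.2.1 = 0
    · rw [hcc0 s h1, hcc0 t h2] at e
      exact .inl ((hP k).cell s hs t ht (hf s (hPU k hs) t (hPU k ht) h1 h2 e) (h1.trans h2.symm))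
    · rw [hcc0 s h1] at e
      exact (hfU s (hPU k hs) h1 t (hPU k ht) (by rw [e, hcc t h2])).elim
    · rw [hcc0 t h2] at e
      exact (hfU t (hPU k ht) h2 s (hPU k hs) (by rw [← e, hcc s h1])).elim
    · exact .inr ⟨by rw [hcc s h1, hcc t h2, e], h1⟩
  have hcell : ∀ k, ∀ s ∈ P k, ∀ t ∈ P k, cr s = cr t → cc s = cc t → s = t := by
    intro k s hs t ht e e'
    rcases hrow k s hs t ht e with h | ⟨h, -⟩
    · exact h
    rcases hcol k s hs t ht e' with h' | ⟨h', -⟩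
    · exact h'
    exact (hP k).cell s hs t ht h h'
  have hex : ∀ k, ∃ B : Fin n → Fin n → Fin (n + 1),
      (∀ i j j', B i j = B i j' → j = j') ∧ (∀ j i i', B i j = B i' j → i = i') ∧
      (∀ i j, B i j ≠ b) ∧ ∀ t ∈ P k, t.2.2 ≠ b → B (cr t) (cc t) = t.2.2 := by
    intro k
    have hσ : ∀ x, ∃ y : Fin n, x ≠ b → b.succAbove y = x := by
      intro x
      by_cases h : x = b
      · exact ⟨⟨0, hn⟩, fun h' => (h' h).elim⟩
      · obtain ⟨y, hy⟩ := Fin.exists_succAbove_eq h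
        exact ⟨y, fun _ => hy⟩
    choose σ hσ using hσ
    have hm : ∀ s ∈ {t ∈ P k | t.2.2 ≠ b}, s ∈ P k ∧ b.succAbove (σ s.2.2) = s.2.2 := fun s hs =>
      ⟨(mem_filter.1 hs).1, hσ _ (mem_filter.1 hs).2⟩
    let Q := {t ∈ P k | t.2.2 ≠ b}.image fun t => (cr t, cc t, σ t.2.2)
    have hQ : IsPartialSquare False Q := by
      refine ⟨?_, ?_, ?_, fun s _ h => h.elim⟩
      · intro s hs s' hs' e1 e2
        obtain ⟨t, ht, rfl⟩ := mem_image.1 hs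
        obtain ⟨t', ht', rfl⟩ := mem_image.1 hs'
        rw [hcell k t (hm t ht).1 t' (hm t' ht').1 e1 e2]
      · intro s hs s' hs' e1 e2 _
        obtain ⟨t, ht, rfl⟩ := mem_image.1 hs
        obtain ⟨t', ht', rfl⟩ := mem_image.1 hs'
        have e3 : t.2.2 = t'.2.2 := by
          rw [← (hm t ht).2, ← (hm t' ht').2]
          exact congrArg _ e2
        rcases hrow k t (hm t ht).1 t' (hm t' ht').1 e1 with h | ⟨h, h0⟩
        · rw [h]
        · rw [(hP k).row t (hm t ht).1 t' (hm t' ht').1 h e3 fun _ e => h0 (Fin.ext e)]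
      · intro s hs s' hs' e1 e2 _
        obtain ⟨t, ht, rfl⟩ := mem_image.1 hs
        obtain ⟨t', ht', rfl⟩ := mem_image.1 hs'
        have e3 : t.2.2 = t'.2.2 := by
          rw [← (hm t ht).2, ← (hm t' ht').2]
          exact congrArg _ e2
        rcases hcol k t (hm t ht).1 t' (hm t' ht').1 e1 with h | ⟨h, h0⟩
        · rw [h]
        · rw [(hP k).col t (hm t ht).1 t' (hm t' ht').1 h e3 fun _ e => h0 (Fin.ext e)]
    obtain ⟨L, hL1, hL2, hL3⟩ := hcomp k Q hQ (by
      intro y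
      have heq : {t ∈ Q | t.2.2 = y} =
          {t ∈ P k | t.2.2 = b.succAbove y}.image fun t => (cr t, cc t, σ t.2.2) := by
        ext s
        simp only [Q, mem_filter, mem_image]
        constructor
        · rintro ⟨⟨t, ⟨ht, htb⟩, rfl⟩, rfl⟩
          exact ⟨t, ⟨ht, (hσ _ htb).symm⟩, rfl⟩
        · rintro ⟨t, ⟨ht, hty⟩, rfl⟩
          have htb : t.2.2 ≠ b := by
            rw [hty]
            exact Fin.succAbove_ne b y
          exact ⟨⟨t, ⟨ht, htb⟩, rfl⟩,
            Fin.succAbove_right_injective (p := b) ((hσ _ htb).trans hty)⟩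
      rw [heq, card_image_of_injOn]
      intro s hs t ht e
      exact hcell k s (mem_filter.1 hs).1 t (mem_filter.1 ht).1 (congrArg Prod.fst e)
        (congrArg (fun x => x.2.1) e))
    refine ⟨fun i j => b.succAbove (L i j), ?_, ?_, fun i j => Fin.succAbove_ne _ _, ?_⟩
    · exact fun i j j' e => hL1 i False.elim (Fin.succAbove_right_injective e)
    · exact fun j i i' e => hL2 j False.elim (Fin.succAbove_right_injective e)
    · intro t ht htb
      have := hL3 _ (mem_image_of_mem _ (mem_filter.2 ⟨ht, htb⟩))
      simp only at this
      simp only [this, hσ _ htb]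
  choose B hB1 hB2 hBb hBP using hex
  let M : ι → Fin n → Fin n → Prop := fun k i j =>
    ∃ t ∈ P k, cr t = i ∧ cc t = j ∧ (t.2.2 = b ↔ t.1 ≠ 0 ∧ t.2.1 ≠ 0)
  have hMB : ∀ k k' i j, M k i j → M k' i j ∧ B k i j = B k' i j := by
    rintro k k' i j ⟨t, ht, rfl, rfl, h⟩
    by_cases h_inner : t.1 ≠ 0 ∧ t.2.1 ≠ 0
    · rw [(hb k t ht h_inner.1 h_inner.2 (h.2 h_inner)).1 k']
      exact ⟨⟨t, ht, rfl, rfl, h⟩, rfl⟩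
    · have ht' : t ∈ P k' := hpend k k' t ht (by tauto)
      have htb : t.2.2 ≠ b := fun e => h_inner (h.1 e)
      exact ⟨⟨t, ht', rfl, rfl, h⟩, by rw [hBP k t ht htb, hBP k' t ht' htb]⟩
  have hmark_row : ∀ k, ∀ s ∈ P k, ∀ t ∈ P k, cr s = cr t →
      (s.2.2 = b ↔ s.1 ≠ 0 ∧ s.2.1 ≠ 0) → (t.2.2 = b ↔ t.1 ≠ 0 ∧ t.2.1 ≠ 0) → s = t := by
    intro k s hs t ht e hsb htb
    rcases hrow k s hs t ht e with h | ⟨h, hs0⟩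
    · exact h
    have ht0 : t.1 ≠ 0 := h ▸ hs0
    by_cases hs1 : s.2.1 = 0 <;> by_cases ht1 : t.2.1 = 0
    · exact (hP k).cell s hs t ht h (hs1.trans ht1.symm)
    · exact (((hb k t ht ht0 ht1 (htb.2 ⟨ht0, ht1⟩)).2 s hs).1 h hs1).elim
    · exact (((hb k s hs hs0 hs1 (hsb.2 ⟨hs0, hs1⟩)).2 t ht).1 h.symm ht1).elim
    · exact (hP k).row s hs t ht h ((hsb.2 ⟨hs0, hs1⟩).trans (htb.2 ⟨ht0, ht1⟩).symm) fun _ e =>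
        hs0 (Fin.ext e)
  have hmark_col : ∀ k, ∀ s ∈ P k, ∀ t ∈ P k, cc s = cc t →
      (s.2.2 = b ↔ s.1 ≠ 0 ∧ s.2.1 ≠ 0) → (t.2.2 = b ↔ t.1 ≠ 0 ∧ t.2.1 ≠ 0) → s = t := by
    intro k s hs t ht e hsb htb
    rcases hcol k s hs t ht e with h | ⟨h, hs0⟩
    · exact h
    have ht0 : t.2.1 ≠ 0 := h ▸ hs0
    by_cases hs1 : s.1 = 0 <;> by_cases ht1 : t.1 = 0
    · exact (hP k).cell s hs t ht (hs1.trans ht1.symm) h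
    · exact (((hb k t ht ht1 ht0 (htb.2 ⟨ht1, ht0⟩)).2 s hs).2 h hs1).elim
    · exact (((hb k s hs hs1 hs0 (hsb.2 ⟨hs1, hs0⟩)).2 t ht).2 h.symm ht1).elim
    · exact (hP k).col s hs t ht h ((hsb.2 ⟨hs1, hs0⟩).trans (htb.2 ⟨ht1, ht0⟩).symm) fun _ e =>
        hs0 (Fin.ext e)
  have hMrow : ∀ k i j j', M k i j → M k i j' → j = j' := by
    rintro k _ _ _ ⟨s, hs, rfl, rfl, hsb⟩ ⟨t, ht, e, rfl, htb⟩
    rw [hmark_row k t ht s hs e htb hsb]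
  have hMcol : ∀ k j i i', M k i j → M k i' j → i = i' := by
    rintro k _ _ _ ⟨s, hs, rfl, rfl, hsb⟩ ⟨t, ht, rfl, e, htb⟩
    rw [hmark_col k t ht s hs e htb hsb]
  have hleft : ∀ k, ∀ t ∈ P k, t.1 ≠ 0 → t.2.1 = 0 → t.2.2 = b → ∀ j, ¬ M k (cr t) j := by
    rintro k t ht ht0 ht1 htb _ ⟨s, hs, e, rfl, hsb⟩
    rcases hrow k s hs t ht e with rfl | ⟨h, hs0⟩
    · exact (hsb.1 htb).2 ht1
    by_cases hs1 : s.2.1 = 0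
    · have := (hP k).cell s hs t ht h (hs1.trans ht1.symm)
      subst this
      exact (hsb.1 htb).2 ht1
    · exact ((hb k s hs hs0 hs1 (hsb.2 ⟨hs0, hs1⟩)).2 t ht).1 h.symm ht1
  have htop : ∀ k, ∀ t ∈ P k, t.2.1 ≠ 0 → t.1 = 0 → t.2.2 = b → ∀ i, ¬ M k i (cc t) := by
    rintro k t ht ht0 ht1 htb _ ⟨s, hs, rfl, e, hsb⟩
    rcases hcol k s hs t ht e with rfl | ⟨h, hs0⟩
    · exact (hsb.1 htb).1 ht1
    by_cases hs1 : s.1 = 0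
    · have := (hP k).cell s hs t ht (hs1.trans ht1.symm) h
      subst this
      exact (hsb.1 htb).1 ht1
    · exact ((hb k s hs hs1 hs0 (hsb.2 ⟨hs1, hs0⟩)).2 t ht).2 h.symm ht1
  obtain ⟨k₀⟩ := ‹Nonempty ι›
  obtain ⟨r, hr⟩ : ∃ r : Fin n → Fin (n + 1), ∀ k i, (∀ j, M k i j → r i = B k i j) ∧
      ((∀ j, ¬ M k i j) → r i = b) := by
    refine ⟨fun i => if h : ∃ j, M k₀ i j then B k₀ i h.choose else b, fun k i => ⟨?_, ?_⟩⟩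
    · intro j hj
      obtain ⟨h1, h2⟩ := hMB k k₀ i j hj
      have hex : ∃ j, M k₀ i j := ⟨j, h1⟩
      simp only [hex, dif_pos]
      rw [h2, hMrow k₀ i _ _ hex.choose_spec h1]
    · intro h
      exact dif_neg fun ⟨j, hj⟩ => h j (hMB k₀ k i j hj).1
  obtain ⟨c, hc⟩ : ∃ c : Fin n → Fin (n + 1), ∀ k j, (∀ i, M k i j → c j = B k i j) ∧
      ((∀ i, ¬ M k i j) → c j = b) := by
    refine ⟨fun j => if h : ∃ i, M k₀ i j then B k₀ h.choose j else b, fun k j => ⟨?_, ?_⟩⟩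
    · intro i hi
      obtain ⟨h1, h2⟩ := hMB k k₀ i j hi
      have hex : ∃ i, M k₀ i j := ⟨i, h1⟩
      simp only [hex, dif_pos]
      rw [h2, hMcol k₀ j _ _ hex.choose_spec h1]
    · intro h
      exact dif_neg fun ⟨i, hi⟩ => h i (hMB k₀ k i j hi).1
  refine ⟨fun k i j => if M k i j then b else B k i j, r, c, fun k => ⟨?_, ?_, ?_, ?_, ?_, ?_, ?_⟩⟩
  · intro i j j' e
    simp only at e
    split_ifs at e with h1 h2 h2
    · exact hMrow k i j j' h1 h2
    · exact (hBb k i j' e.symm).elim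
    · exact (hBb k i j e).elim
    · exact hB1 k i j j' e
  · intro j i i' e
    simp only at e
    split_ifs at e with h1 h2 h2
    · exact hMcol k j i i' h1 h2
    · exact (hBb k i' j e.symm).elim
    · exact (hBb k i j e).elim
    · exact hB2 k j i i' e
  · intro i j e
    by_cases h : M k i j
    · simp only [h, if_true, (hr k i).1 j h] at e
      exact hBb k i j e.symm
    · simp only [h, if_false] at e
      by_cases h' : ∃ j', M k i j'
      · obtain ⟨j', hj'⟩ := h'
        rw [(hr k i).1 j' hj'] at e
        exact h (hB1 k i j j' e ▸ hj')
      · rw [(hr k i).2 fun j' hj' => h' ⟨j', hj'⟩] at e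
        exact hBb k i j e
  · intro i j e
    by_cases h : M k i j
    · simp only [h, if_true, (hc k j).1 i h] at e
      exact hBb k i j e.symm
    · simp only [h, if_false] at e
      by_cases h' : ∃ i', M k i' j
      · obtain ⟨i', hi'⟩ := h'
        rw [(hc k j).1 i' hi'] at e
        exact h (hB2 k j i i' e ▸ hi')
      · rw [(hc k j).2 fun i' hi' => h' ⟨i', hi'⟩] at e
        exact hBb k i j e
  · intro i j x hx
    have hri : cr (i.succ, j.succ, x) = i := Fin.succ_injective _ (hcr _ (Fin.succ_ne_zero i)).symm
    have hcj : cc (i.succ, j.succ, x) = j := Fin.succ_injective _ (hcc _ (Fin.succ_ne_zero j)).symm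
    by_cases hxb : x = b
    · have hM : M k i j := ⟨_, hx, hri, hcj, by simp [hxb]⟩
      simp only [hM, if_true, hxb]
    · have hM : ¬ M k i j := by
        rintro ⟨t, ht, hti, htj, htb⟩
        have := hcell k _ hx t ht (hri.trans hti.symm) (hcj.trans htj.symm)
        subst this
        exact hxb (htb.2 (by simp))
      have := hBP k _ hx hxb
      rw [hri, hcj] at this
      simpa only [hM, if_false] using this
  · intro i x hx
    have hri : cr (i.succ, 0, x) = i := Fin.succ_injective _ (hcr _ (Fin.succ_ne_zero i)).symm
    by_cases hxb : x = b
    · rw [(hr k i).2, hxb]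
      exact hri ▸ hleft k _ hx (Fin.succ_ne_zero i) rfl hxb
    · rw [(hr k i).1 (cc (i.succ, 0, x)) ⟨_, hx, hri, rfl, by simp [hxb]⟩]
      have := hBP k _ hx hxb
      rwa [hri] at this
  · intro j x hx
    have hcj : cc (0, j.succ, x) = j := Fin.succ_injective _ (hcc _ (Fin.succ_ne_zero j)).symm
    by_cases hxb : x = b
    · rw [(hc k j).2, hxb]
      exact hcj ▸ htop k _ hx (Fin.succ_ne_zero j) rfl hxb
    · rw [(hc k j).1 (cr (0, j.succ, x)) ⟨_, hx, rfl, hcj, by simp [hxb]⟩]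
      have := hBP k _ hx hxb
      rwa [hcj] at this

theorem card_add_card_eq_of_succAbove {n : ℕ}
    {P : Finset (Fin (n + 1) × Fin (n + 1) × Fin (n + 1))} {Q : Finset (Fin n × Fin n × Fin n)}
    (b : Fin (n + 1)) (h : ∀ y, #{t ∈ Q | t.2.2 = y} = #{t ∈ P | t.2.2 = b.succAbove y}) :
    #{t ∈ P | t.2.2 = b} + #Q = #P := by
  rw [card_eq_sum_card_fiberwise (f := fun t => t.2.2) (s := P) (t := univ) (by simp),
    card_eq_sum_card_fiberwise (f := fun t => t.2.2) (s := Q) (t := univ) (by simp),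
    Fin.sum_univ_succAbove _ b]
  simp only [h]

theorem IsPartialSquare.transpose {sp : Prop} {n : ℕ} {P : Finset (Fin n × Fin n × Fin n)}
    (hP : IsPartialSquare sp P) :
    IsPartialSquare sp (P.image fun t => (t.2.1, t.1, t.2.2)) := by
  refine ⟨?_, ?_, ?_, ?_⟩
  · intro s hs t ht e1 e2
    obtain ⟨s, hs', rfl⟩ := mem_image.1 hs
    obtain ⟨t, ht', rfl⟩ := mem_image.1 ht
    rw [hP.cell s hs' t ht' e2 e1]
  · intro s hs t ht e1 e2 h
    obtain ⟨s, hs', rfl⟩ := mem_image.1 hs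
    obtain ⟨t, ht', rfl⟩ := mem_image.1 ht
    rw [hP.col s hs' t ht' e1 e2 h]
  · intro s hs t ht e1 e2 h
    obtain ⟨s, hs', rfl⟩ := mem_image.1 hs
    obtain ⟨t, ht', rfl⟩ := mem_image.1 ht
    rw [hP.row s hs' t ht' e1 e2 h]
  · intro s hs h
    obtain ⟨s, hs', rfl⟩ := mem_image.1 hs
    exact (hP.corner s hs' h).symm

theorem IsCompletable.of_transpose {sp : Prop} {n : ℕ} {P : Finset (Fin n × Fin n × Fin n)}
    (h : IsCompletable sp (P.image fun t => (t.2.1, t.1, t.2.2))) : IsCompletable sp P := by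
  obtain ⟨L, h1, h2, h3⟩ := h
  exact ⟨fun i j => L j i, h2, h1, fun t ht => h3 _ (mem_image_of_mem _ ht)⟩

theorem isCompletable_of_left_mem {n : ℕ}
    (ih : ∀ P : Finset (Fin (n + 1) × Fin (n + 1) × Fin (n + 1)), IsPartialSquare True P →
      #P ≤ n → IsCompletable True P)
    (P : Finset (Fin (n + 1 + 1) × Fin (n + 1 + 1) × Fin (n + 1 + 1)))
    (hP : IsPartialSquare True P) (hcard : #P ≤ n + 1) (hnot : ¬ IsPartialSquare False P)
    (t₀ : Fin (n + 1 + 1) × Fin (n + 1 + 1) × Fin (n + 1 + 1)) (ht₀ : t₀ ∈ P)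
    (huniq : ∀ t ∈ P, t.2.2 = t₀.2.2 → t = t₀) (h1 : t₀.1 ≠ 0) (h2 : t₀.2.1 ≠ 0)
    (hs : ∃ s ∈ P, s.1 = t₀.1 ∧ s.2.1 = 0) : IsCompletable True P := by
  classical
  obtain ⟨s, hs, hs1, hs2⟩ := hs
  have hF : ∀ t ∈ P, t.1 = 0 ∨ t.2.1 = 0 → ∃ k, (t.1, t.2.1, k) ∈ P.erase t₀ := by
    rintro t ht h
    refine ⟨t.2.2, mem_erase.2 ⟨?_, ht⟩⟩
    rintro rfl
    exact h.elim h1 h2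
  have h0 : ∃ t ∈ P, (t.1, t.2.1) ≠ (t₀.1, (0 : Fin (n + 1 + 1))) ∧ (t.1 = 0 ∨ t.2.1 = 0) := by
    by_contra! hcon
    refine hnot ⟨hP.cell, ?_, ?_, fun s _ h => h.elim⟩
    · intro s hs t ht e e' _
      refine hP.row s hs t ht e e' fun _ h0 => ?_
      have h0 : s.1 = 0 := Fin.ext h0
      exact (hcon s hs (fun e => h1 ((congrArg Prod.fst e).symm.trans h0))).1 h0
    · intro s hs t ht e e' _
      by_cases h0 : s.2.1 = 0
      · have hall : ∀ t ∈ P, t.2.1 = 0 → t.1 = t₀.1 := by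
          intro t ht h0
          by_contra hne
          exact (hcon t ht fun e => hne (Prod.mk.inj e).1).2 h0
        exact hP.cell s hs t ht ((hall s hs h0).trans (hall t ht (e ▸ h0)).symm) e
      · exact hP.col s hs t ht e e' fun _ h => h0 (Fin.ext h)
  obtain ⟨t, ht, hne, ht0⟩ := h0
  obtain ⟨π, ρ, h, hπ, hρ⟩ := exists_isArrangement_zero (fun i j => ∃ k, (i, j, k) ∈ P.erase t₀)
    t₀.1 t₀.2.1 h1 h2
    (by
      rintro ⟨k, hk⟩
      exact (mem_erase.1 hk).1 (hP.cell _ (mem_of_mem_erase hk) t₀ ht₀ rfl rfl))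
    ((P.erase t₀).image fun t => (t.1, t.2.1))
    (by
      rintro ⟨i, j⟩
      constructor
      · intro h
        obtain ⟨t, ht, e⟩ := mem_image.1 h
        obtain ⟨rfl, rfl⟩ := Prod.mk.inj e
        exact ⟨t.2.2, ht⟩
      · rintro ⟨k, hk⟩
        exact mem_image.2 ⟨_, hk, rfl⟩)
    (by
      have := card_image_le (s := P.erase t₀) (f := fun t => (t.1, t.2.1))
      have := card_erase_add_one ht₀
      omega)
    (by
      rw [← hs1, ← hs2]
      exact hF s hs (.inr hs2))
    ⟨t.1, t.2.1, hF t ht ht0, hne, ht0⟩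
  exact isCompletable_of_isArrangement (by omega) True P hP t₀ ht₀ huniq π ρ h
    (fun _ => ⟨hπ, hρ⟩) fun P' hP' hlt => ih P' hP' (by omega)

theorem IsPartialSquare.isCompletable {n : ℕ}
    {P : Finset (Fin (n + 1) × Fin (n + 1) × Fin (n + 1))} (hP : IsPartialSquare True P)
    (hcard : #P ≤ n) : IsCompletable True P := by
  classical
  induction n with
  | zero =>
    rw [card_eq_zero.1 (Nat.le_zero.1 hcard)]
    exact ⟨fun _ _ => 0, fun i h => (h trivial (by omega)).elim,
      fun i h => (h trivial (by omega)).elim, by simp⟩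
  | succ n ih =>
  by_cases hF : IsPartialSquare False P
  · obtain ⟨L, h1, h2, h3⟩ := isCompletable_of_card_lt _ P hF (by omega)
    exact ⟨L, fun i _ => h1 i False.elim, fun j _ => h2 j False.elim, h3⟩
  have key : ∀ b : Fin (n + 1 + 1),
      (∀ t ∈ P, t.1 ≠ 0 → t.2.1 ≠ 0 → t.2.2 = b →
        ∀ s ∈ P, (s.1 = t.1 → s.2.1 ≠ 0) ∧ (s.2.1 = t.2.1 → s.1 ≠ 0)) →
      (∀ Q : Finset (Fin (n + 1) × Fin (n + 1) × Fin (n + 1)), IsPartialSquare False Q →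
        (∀ y, #{t ∈ Q | t.2.2 = y} = #{t ∈ P | t.2.2 = b.succAbove y}) →
        IsCompletable False Q) → IsCompletable True P := by
    intro b hb hQ
    obtain ⟨A, r, c, h⟩ := exists_isSolution (by omega) (fun _ : Unit => P) (fun _ => hP) P
      (fun _ => subset_rfl) hcard (fun _ _ t ht _ => ht) b
      (fun _ t ht h1 h2 h3 => ⟨fun _ => rfl, hb t ht h1 h2 h3⟩) (fun _ => hQ)
    exact (h ()).isCompletable hP
  by_cases hsing : ∀ k, #{t ∈ P | t.2.2 = k} ≠ 1
  · obtain ⟨b, -, hb⟩ : ∃ b ∈ univ, b ∉ P.image fun t => t.2.2 := by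
      refine exists_mem_notMem_of_card_lt_card (card_image_le.trans_lt ?_)
      rw [card_univ, Fintype.card_fin]
      omega
    have hb' : ∀ t ∈ P, t.2.2 ≠ b := fun t ht e => hb (mem_image.2 ⟨t, ht, e⟩)
    refine key b (fun t ht _ _ e => (hb' t ht e).elim) fun Q hQ hQc => ?_
    have := card_add_card_eq_of_succAbove b hQc
    exact isCompletable_of_no_singleton Q hQ (by omega) fun k => by rw [hQc]; exact hsing _
  push Not at hsing
  obtain ⟨z, hz⟩ := hsing
  obtain ⟨t₀, ht₀⟩ := card_eq_one.1 hz
  have hmem : t₀ ∈ P ∧ t₀.2.2 = z := mem_filter.1 (ht₀ ▸ mem_singleton_self t₀)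
  have huniq : ∀ t ∈ P, t.2.2 = z → t = t₀ := fun t ht e =>
    mem_singleton.1 (ht₀ ▸ mem_filter.2 ⟨ht, e⟩)
  by_cases hfree : t₀.1 ≠ 0 → t₀.2.1 ≠ 0 →
      ∀ s ∈ P, (s.1 = t₀.1 → s.2.1 ≠ 0) ∧ (s.2.1 = t₀.2.1 → s.1 ≠ 0)
  · refine key z (fun t ht h1 h2 e => ?_) fun Q hQ hQc => ?_
    · rw [huniq t ht e] at h1 h2 ⊢
      exact hfree h1 h2
    · have := card_add_card_eq_of_succAbove z hQc
      exact isCompletable_of_card_lt _ Q hQ (by omega)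
  push Not at hfree
  obtain ⟨h1, h2, s, hs, h3⟩ := hfree
  have hu : ∀ t ∈ P, t.2.2 = t₀.2.2 → t = t₀ := fun t ht e => huniq t ht (e.trans hmem.2)
  by_cases hs1 : s.1 = t₀.1 ∧ s.2.1 = 0
  · exact isCompletable_of_left_mem (fun P hP h => ih hP h) P hP hcard hF t₀ hmem.1 hu h1 h2
      ⟨s, hs, hs1⟩
  · have hs2 : s.2.1 = t₀.2.1 ∧ s.1 = 0 := h3 fun e e' => hs1 ⟨e, e'⟩
    refine IsCompletable.of_transpose (isCompletable_of_left_mem (fun P hP h => ih hP h) _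
      hP.transpose (card_image_le.trans hcard) (fun h => hF ?_) (t₀.2.1, t₀.1, t₀.2.2)
      (mem_image.2 ⟨t₀, hmem.1, rfl⟩) ?_ h2 h1 ⟨(s.2.1, s.1, s.2.2), mem_image.2 ⟨s, hs, rfl⟩, hs2⟩)
    · have := h.transpose
      rwa [image_image, show ((fun t : Fin (n + 1 + 1) × Fin (n + 1 + 1) × Fin (n + 1 + 1) =>
        (t.2.1, t.1, t.2.2)) ∘ fun t => (t.2.1, t.1, t.2.2)) = id from rfl, image_id] at this
    · intro t ht e
      obtain ⟨t, htP, rfl⟩ := mem_image.1 ht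
      rw [hu t htP e]

/-- The edge of `K_{n,n} □ K_2` at the cell `(i, j)`: an edge of the copy `k` of `K_{n,n}` if
`i, j ≠ 0`, and a matching edge if one of them is `0`. The corner cell gets the loop at `v`. -/
def cellEdge {n : ℕ} (v : (Fin n ⊕ Fin n) × Fin 2) (k : Fin 2) (i j : Fin (n + 1)) :
    Sym2 ((Fin n ⊕ Fin n) × Fin 2) :=
  Fin.cases
    (Fin.cases s(v, v) (fun j => s((Sum.inr j, 0), (Sum.inr j, 1))) j)
    (fun i => Fin.cases s((Sum.inl i, 0), (Sum.inl i, 1))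
      (fun j => s((Sum.inl i, k), (Sum.inr j, k))) j) i

theorem cellEdge_inj {n : ℕ} (v : (Fin n ⊕ Fin n) × Fin 2) {k k' : Fin 2}
    {i j i' j' : Fin (n + 1)} (h : cellEdge v k i j = cellEdge v k' i' j')
    (h0 : i ≠ 0 ∨ j ≠ 0) : i = i' ∧ j = j' ∧ (i = 0 ∨ j = 0 ∨ k = k') := by
  induction i using Fin.cases <;> induction j using Fin.cases <;>
    induction i' using Fin.cases <;> induction j' using Fin.cases <;>
    simp_all [cellEdge] <;> grind

theorem cellEdge_congr {n : ℕ} (v : (Fin n ⊕ Fin n) × Fin 2) (k k' : Fin 2)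
    {i j : Fin (n + 1)} (h : i = 0 ∨ j = 0) : cellEdge v k i j = cellEdge v k' i j := by
  induction i using Fin.cases <;> induction j using Fin.cases <;> simp_all [cellEdge]

theorem inl_mem_cellEdge {n : ℕ} (v : (Fin n ⊕ Fin n) × Fin 2) (k : Fin 2) (i : Fin n)
    (j : Fin (n + 1)) : (Sum.inl i, k) ∈ cellEdge v k i.succ j := by
  induction j using Fin.cases
  · fin_cases k <;> simp [cellEdge]
  · simp [cellEdge]

theorem inr_mem_cellEdge {n : ℕ} (v : (Fin n ⊕ Fin n) × Fin 2) (k : Fin 2) (i : Fin (n + 1))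
    (j : Fin n) : (Sum.inr j, k) ∈ cellEdge v k i j.succ := by
  induction i using Fin.cases
  · fin_cases k <;> simp [cellEdge]
  · simp [cellEdge]

/-- The colour of an ordered pair of adjacent vertices of `K_{n,n} □ K_2`. -/
def pairColor {n : ℕ} (A : Fin 2 → Fin n → Fin n → Fin (n + 1)) (r c : Fin n → Fin (n + 1)) :
    (Fin n ⊕ Fin n) × Fin 2 → (Fin n ⊕ Fin n) × Fin 2 → Fin (n + 1)
  | (Sum.inl i, k), (Sum.inr j, _) => A k i j
  | (Sum.inr j, k), (Sum.inl i, _) => A k i j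
  | (Sum.inl i, _), (Sum.inl _, _) => r i
  | (Sum.inr j, _), (Sum.inr _, _) => c j

theorem pairColor_comm {n : ℕ} (A : Fin 2 → Fin n → Fin n → Fin (n + 1)) (r c : Fin n → Fin (n + 1))
    {x y : (Fin n ⊕ Fin n) × Fin 2}
    (h : ((completeBipartiteGraph (Fin n) (Fin n)).boxProd (⊤ : SimpleGraph (Fin 2))).Adj x y) :
    pairColor A r c x y = pairColor A r c y x := by
  obtain ⟨x | x, k⟩ := x <;> obtain ⟨y | y, l⟩ := y <;>
    simp_all [pairColor, SimpleGraph.boxProd_adj]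

theorem pairColor_ne {n : ℕ} {P : Fin 2 → Finset (Fin (n + 1) × Fin (n + 1) × Fin (n + 1))}
    {A : Fin 2 → Fin n → Fin n → Fin (n + 1)} {r c : Fin n → Fin (n + 1)}
    (hA : ∀ k, IsSolution (P k) (A k) r c) {v x y : (Fin n ⊕ Fin n) × Fin 2}
    (hx : ((completeBipartiteGraph (Fin n) (Fin n)).boxProd (⊤ : SimpleGraph (Fin 2))).Adj v x)
    (hy : ((completeBipartiteGraph (Fin n) (Fin n)).boxProd (⊤ : SimpleGraph (Fin 2))).Adj v y)
    (hxy : x ≠ y) : pairColor A r c v x ≠ pairColor A r c v y := by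
  intro h
  obtain ⟨v | v, k⟩ := v <;> obtain ⟨x | x, l⟩ := x <;> obtain ⟨y | y, m⟩ := y <;>
    simp [pairColor, SimpleGraph.boxProd_adj] at hx hy h hxy
  · omega
  · exact (hA k).ne_row _ _ h.symm
  · exact (hA k).ne_row _ _ h
  · exact hxy ((hA k).row_inj _ _ _ h) (hx.symm.trans hy)
  · exact hxy ((hA k).col_inj _ _ _ h) (hx.symm.trans hy)
  · exact (hA k).ne_col _ _ h
  · exact (hA k).ne_col _ _ h.symm
  · omega

theorem extendable_of_isSolution {n : ℕ} (v : (Fin n ⊕ Fin n) × Fin 2)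
    (φ : Sym2 ((Fin n ⊕ Fin n) × Fin 2) → Option ℕ)
    (hφ : IsPartialProperEdgeColoring
      ((completeBipartiteGraph (Fin n) (Fin n)).boxProd (⊤ : SimpleGraph (Fin 2))) φ)
    {P : Fin 2 → Finset (Fin (n + 1) × Fin (n + 1) × Fin (n + 1))}
    (hP : ∀ k i j a, φ (cellEdge v k i j) = some a → ∃ x, (i, j, x) ∈ P k ∧ x.val = a)
    {A : Fin 2 → Fin n → Fin n → Fin (n + 1)} {r c : Fin n → Fin (n + 1)}
    (hA : ∀ k, IsSolution (P k) (A k) r c) :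
    Extendable ((completeBipartiteGraph (Fin n) (Fin n)).boxProd (⊤ : SimpleGraph (Fin 2)))
      φ (n + 1) := by
  set G := (completeBipartiteGraph (Fin n) (Fin n)).boxProd (⊤ : SimpleGraph (Fin 2)) with hG
  let C : Sym2 ((Fin n ⊕ Fin n) × Fin 2) → ℕ := fun e =>
    pairColor A r c (Quot.out e).1 (Quot.out e).2
  have hC : ∀ x y, G.Adj x y → C s(x, y) = pairColor A r c x y := by
    intro x y h
    have hout : s((Quot.out s(x, y)).1, (Quot.out s(x, y)).2) = s(x, y) := Quot.out_eq s(x, y)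
    rcases Sym2.eq_iff.1 hout with ⟨h1, h2⟩ | ⟨h1, h2⟩
    · simp only [C, h1, h2]
    · simp only [C, h1, h2, pairColor_comm A r c h]
  refine ⟨C, ?_, fun e _ => Fin.isLt _, ?_⟩
  · rintro e f ⟨he, hf, hef, v, hve, hvf⟩
    obtain ⟨x, rfl⟩ := hve
    obtain ⟨y, rfl⟩ := hvf
    rw [hC v x he, hC v y hf]
    exact fun h => pairColor_ne hA he hf (fun e : x = y => hef (by rw [e])) (Fin.ext h)
  · intro e a hea
    have he := hφ.1 e (by simp [hea])
    induction e with | _ x y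
    rw [hC x y he]
    have hinner : ∀ k i j, φ s((Sum.inl i, k), (Sum.inr j, k)) = some a → (A k i j).val = a := by
      intro k i j h
      obtain ⟨x, hx, rfl⟩ := hP k i.succ j.succ a h
      rw [(hA k).inner i j x hx]
    have hleft : ∀ i, φ s((Sum.inl i, 0), (Sum.inl i, 1)) = some a → (r i).val = a := by
      intro i h
      obtain ⟨x, hx, rfl⟩ := hP 0 i.succ 0 a h
      rw [(hA 0).left i x hx]
    have htop : ∀ j, φ s((Sum.inr j, 0), (Sum.inr j, 1)) = some a → (c j).val = a := by
      intro j h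
      obtain ⟨x, hx, rfl⟩ := hP 0 0 j.succ a h
      rw [(hA 0).top j x hx]
    have hfin : ∀ k l : Fin 2, k ≠ l → k = 0 ∧ l = 1 ∨ k = 1 ∧ l = 0 := by omega
    obtain ⟨x | x, k⟩ := x <;> obtain ⟨y | y, l⟩ := y <;>
      simp [hG, SimpleGraph.boxProd_adj] at he
    · obtain ⟨hkl, rfl⟩ := he
      rcases hfin k l hkl with ⟨rfl, rfl⟩ | ⟨rfl, rfl⟩
      · exact hleft x hea
      · exact hleft x (Sym2.eq_swap ▸ hea)
    · subst he
      exact hinner _ _ _ hea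
    · subst he
      exact hinner _ _ _ (Sym2.eq_swap ▸ hea)
    · obtain ⟨hkl, rfl⟩ := he
      rcases hfin k l hkl with ⟨rfl, rfl⟩ | ⟨rfl, rfl⟩
      · exact htop x hea
      · exact htop x (Sym2.eq_swap ▸ hea)

theorem stmt8 (n : ℕ) (hn : 2 ≤ n)
    (φ : Sym2 ((Fin n ⊕ Fin n) × Fin 2) → Option ℕ)
    (hφ : IsPartialProperEdgeColoring
      ((completeBipartiteGraph (Fin n) (Fin n)).boxProd (⊤ : SimpleGraph (Fin 2))) φ)
    (hc : UsesColors φ n) (hcard : (Precolored φ).ncard ≤ n) :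
    Extendable ((completeBipartiteGraph (Fin n) (Fin n)).boxProd (⊤ : SimpleGraph (Fin 2)))
      φ (n + 1) := by
  classical
  let v : (Fin n ⊕ Fin n) × Fin 2 := (Sum.inl ⟨0, by omega⟩, 0)
  let P : Fin 2 → Finset (Fin (n + 1) × Fin (n + 1) × Fin (n + 1)) := fun k =>
    {t | φ (cellEdge v k t.1 t.2.1) = some t.2.2.val}
  have hmem : ∀ k t, t ∈ P k ↔ φ (cellEdge v k t.1 t.2.1) = some t.2.2.val := fun k t => by
    simp [P]
  have hvv : φ s(v, v) = none := by
    by_contra h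
    exact SimpleGraph.irrefl _ ((SimpleGraph.mem_edgeSet _).1 (hφ.1 _ h))
  have hcorner : ∀ k, ∀ t ∈ P k, t.1 ≠ 0 ∨ t.2.1 ≠ 0 := by
    rintro k ⟨i, j, x⟩ ht
    by_contra! h
    obtain ⟨rfl, rfl⟩ : i = 0 ∧ j = 0 := h
    have := (hmem _ _).1 ht
    simp [cellEdge, hvv] at this
  have hadj : ∀ k, ∀ s ∈ P k, ∀ t ∈ P k, s.2.2 = t.2.2 → ∀ w,
      w ∈ cellEdge v k s.1 s.2.1 → w ∈ cellEdge v k t.1 t.2.1 → s = t := by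
    intro k s hs t ht e w hw hw'
    have hs' := (hmem k s).1 hs
    have ht' := (hmem k t).1 ht
    by_cases heq : cellEdge v k s.1 s.2.1 = cellEdge v k t.1 t.2.1
    · obtain ⟨h1, h2, -⟩ := cellEdge_inj v heq (hcorner k s hs)
      exact Prod.ext h1 (Prod.ext h2 e)
    · refine (hφ.2 ⟨hφ.1 _ (by simp [hs']), hφ.1 _ (by simp [ht']), heq, w, hw, hw'⟩
        (by simp [hs']) ?_).elim
      rw [hs', ht', e]
  have hP : ∀ k, IsPartialSquare True (P k) := by
    intro k
    refine ⟨?_, ?_, ?_, ?_⟩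
    · intro s hs t ht e1 e2
      have hs' := (hmem k s).1 hs
      have ht' := (hmem k t).1 ht
      rw [e1, e2, ht'] at hs'
      exact Prod.ext e1 (Prod.ext e2 (Fin.ext (Option.some.inj hs').symm))
    · rintro s hs t ht e1 e2 h
      obtain ⟨i, hi⟩ := Fin.exists_succ_eq.2 fun e : s.1 = 0 => h trivial (congrArg Fin.val e)
      refine hadj k s hs t ht e2 (Sum.inl i, k) ?_ ?_
      · rw [← hi]
        exact inl_mem_cellEdge v k i _
      · rw [← e1, ← hi]
        exact inl_mem_cellEdge v k i _
    · rintro s hs t ht e1 e2 h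
      obtain ⟨j, hj⟩ := Fin.exists_succ_eq.2 fun e : s.2.1 = 0 => h trivial (congrArg Fin.val e)
      refine hadj k s hs t ht e2 (Sum.inr j, k) ?_ ?_
      · rw [← hj]
        exact inr_mem_cellEdge v k _ j
      · rw [← e1, ← hj]
        exact inr_mem_cellEdge v k _ j
    · intro t ht _
      exact (hcorner k t ht).imp (fun h e => h (Fin.ext e)) (fun h e => h (Fin.ext e))
  have hpend : ∀ k k', ∀ t ∈ P k, t.1 = 0 ∨ t.2.1 = 0 → t ∈ P k' := by
    rintro k k' ⟨i, j, x⟩ ht h0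
    have ht' := (hmem _ _).1 ht
    rw [hmem, ← ht', cellEdge_congr v k' k h0]
  have hext : ∀ k k', ∀ s ∈ P k, ∀ t ∈ P k',
      cellEdge v k s.1 s.2.1 = cellEdge v k' t.1 t.2.1 →
      s = t ∧ (s.1 = 0 ∨ s.2.1 = 0 ∨ k = k') := by
    intro k k' s hs t ht e
    have hs' := (hmem k s).1 hs
    have ht' := (hmem k' t).1 ht
    obtain ⟨h1, h2, h3⟩ := cellEdge_inj v e (hcorner k s hs)
    rw [e, ht'] at hs'
    exact ⟨Prod.ext h1 (Prod.ext h2 (Fin.ext (Option.some.inj hs').symm)), h3⟩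
  let F : Finset (Sym2 ((Fin n ⊕ Fin n) × Fin 2)) := {e | φ e ≠ none}
  have hFn : #F ≤ n := by
    rwa [show Precolored φ = (F : Set (Sym2 ((Fin n ⊕ Fin n) × Fin 2))) by
      ext; simp [F, Precolored], Set.ncard_coe_finset] at hcard
  have hF : ∀ k, ∀ t ∈ P k, cellEdge v k t.1 t.2.1 ∈ F := fun k t ht =>
    mem_filter.2 ⟨mem_univ _, by simp [(hmem k t).1 ht]⟩
  have hPn : ∀ k, #(P k) ≤ n := fun k =>
    (card_le_card_of_injOn (fun t => cellEdge v k t.1 t.2.1) (fun t ht => hF k t ht)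
      fun s hs t ht e => (hext k k s hs t ht e).1).trans hFn
  have hPlt : ∀ k k', k ≠ k' → (∃ t ∈ P k', t.1 ≠ 0 ∧ t.2.1 ≠ 0) → #(P k) < n := by
    rintro k k' hk ⟨t, ht, h1, h2⟩
    have : #(P k) ≤ #(F.erase (cellEdge v k' t.1 t.2.1)) := by
      refine card_le_card_of_injOn (fun t => cellEdge v k t.1 t.2.1) (fun s hs => ?_)
        fun s hs t ht e => (hext k k s hs t ht e).1
      refine mem_erase.2 ⟨fun e => ?_, hF k s hs⟩
      rcases (hext k' k t ht s hs e.symm).2 with h | h | h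
      · exact h1 h
      · exact h2 h
      · exact hk h.symm
    have := card_erase_add_one (hF k' t ht)
    omega
  suffices h : ∃ (A : Fin 2 → Fin n → Fin n → Fin (n + 1)) (r c : Fin n → Fin (n + 1)),
      ∀ k, IsSolution (P k) (A k) r c by
    obtain ⟨A, r, c, hA⟩ := h
    refine extendable_of_isSolution v φ hφ (fun k i j a h => ?_) hA
    exact ⟨⟨a, (hc _ a h).trans (Nat.lt_succ_self n)⟩, (hmem _ _).2 h, rfl⟩
  by_cases hsub : ∃ k, ∀ k', P k' ⊆ P k
  · obtain ⟨k, hk⟩ := hsub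
    obtain ⟨A, r, c, h⟩ := ((hP k).isCompletable (hPn k)).exists_isSolution
    exact ⟨fun _ => A, r, c, fun k' => h.mono (hk k')⟩
  have hinner : ∀ k, ∃ t ∈ P k, t.1 ≠ 0 ∧ t.2.1 ≠ 0 := by
    intro k
    by_contra! hcon
    refine hsub ⟨k + 1, fun k' => ?_⟩
    by_cases hk : k' = k
    · subst hk
      exact fun t ht => hpend _ _ t ht (or_iff_not_imp_left.2 (hcon t ht))
    · rw [show k' = k + 1 by omega]
  have hlt : ∀ k, #(P k) < n := fun k => hPlt k (k + 1) (by omega) (hinner _)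
  refine exists_isSolution (by omega) P hP (P 0 ∪ P 1) ?_ ?_ hpend (Fin.last n) ?_ ?_
  · intro k
    fin_cases k
    · exact subset_union_left
    · exact subset_union_right
  · have hex : ∀ t, ∃ k, t ∈ P 0 ∪ P 1 → t ∈ P k := by
      intro t
      by_cases h : t ∈ P 0
      · exact ⟨0, fun _ => h⟩
      · exact ⟨1, fun h' => (mem_union.1 h').resolve_left h⟩
    choose κ hκ using hex
    exact (card_le_card_of_injOn (fun t => cellEdge v (κ t) t.1 t.2.1)
      (fun t ht => hF _ t (hκ t ht))
      fun s hs t ht e => (hext _ _ s (hκ s hs) t (hκ t ht) e).1).trans hFn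
  · intro k t ht _ _ e
    have := hc _ _ ((hmem k t).1 ht)
    rw [e] at this
    exact (lt_irrefl _ this).elim
  · intro k Q hQ hQc
    have := card_add_card_eq_of_succAbove _ hQc
    have := hlt k
    exact isCompletable_of_card_lt n Q hQ (by omega)
end
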